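/- arXiv:1906.06232 — 2 statements merged into one kernel-verified Lean document; each statement's English description precedes it below -/
import Mathlib

section
/- Let M_p be a weight sequence satisfying (M.1) and (M.2)' with constants A, H. Let ψ : ℝ^d → ℂ be smooth with supp ψ ⊆ B̄(0,R₀) and such that sup_{α∈ℕ^d} sup_{x∈ℝ^d} |∂^αψ(x)|/(ℓ^{|α|}M_α) < ∞ for every ℓ > 0. Then for every R > R₀ and every k ∈ ℕ there exist ℓ > 0 (one may take ℓ = π/(k H^k √d)) and C > 0 such that for every smooth compactly supported φ : ℝ^d → ℂ with supp φ ⊆ B̄(0,R) and ‖φ‖_{E^{M_p,ℓ}(B̄(0,R))} < ∞ one has: V_ψφ(x,ξ) = 0 whenever |x| > 2R, and sup_{|α|≤k, |β|≤k} sup_{(x,ξ)∈ℝ^{2d}} |∂_x^α ∂_ξ^β V_ψφ(x,ξ)| e^{M(k|ξ|)} ≤ C ‖φ‖_{E^{M_p,ℓ}(B̄(0,R))}. -/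
open MeasureTheory Real
open scoped BigOperators Pointwise

noncomputable section

/-- `ℝ^d` with the Euclidean norm. -/
abbrev Rd (d : ℕ) := EuclideanSpace ℝ (Fin d)

/-- Condition (M.1): a positive, logarithmically convex weight sequence. -/
def IsM1 (M : ℕ → ℝ) : Prop :=
  (∀ p, 0 < M p) ∧ ∀ p : ℕ, 1 ≤ p → (M p) ^ 2 ≤ M (p - 1) * M (p + 1)

/-- Condition (M.2)'. -/
def IsM2' (M : ℕ → ℝ) : Prop :=
  ∃ A H : ℝ, 1 ≤ A ∧ 1 ≤ H ∧ ∀ p : ℕ, M (p + 1) ≤ A * H ^ p * M p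

/-- Condition (M.2). -/
def IsM2 (M : ℕ → ℝ) : Prop :=
  ∃ A H : ℝ, 1 ≤ A ∧ 1 ≤ H ∧ ∀ p q : ℕ, M (p + q) ≤ A * H ^ (p + q) * M p * M q

/-- Condition (M.3)'. -/
def IsM3' (M : ℕ → ℝ) : Prop := Summable fun p : ℕ => M p / M (p + 1)

/-- Condition (M.3). -/
def IsM3 (M : ℕ → ℝ) : Prop :=
  IsM3' M ∧ ∃ c₀ > (0 : ℝ), ∀ q : ℕ, 1 ≤ q →
    (∑' j : ℕ, M (q + j - 1) / M (q + j)) ≤ c₀ * q * (M (q - 1) / M q)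

/-- The associated function `M(t) = sup_p log (t^p M 0 / M p)`, with `M(0) = 0`. -/
def assocFn (M : ℕ → ℝ) (t : ℝ) : ℝ :=
  if t = 0 then 0 else ⨆ p : ℕ, Real.log (t ^ p * M 0 / M p)

variable {d : ℕ}

/-- The partial derivative in the `i`-th coordinate direction. -/
def pder (i : Fin d) (f : Rd d → ℂ) : Rd d → ℂ :=
  fun x => fderiv ℝ f x (EuclideanSpace.single i 1)

/-- The multi-index partial derivative `∂^α`. -/
def mderiv (α : Fin d → ℕ) (f : Rd d → ℂ) : Rd d → ℂ :=
  (List.finRange d).foldr (fun i g => (pder i)^[α i] g) f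

/-- The order `|α|` of a multi-index. -/
def mOrd (α : Fin d → ℕ) : ℕ := ∑ i, α i

/-- The factorial `α!` of a multi-index. -/
def mFact (α : Fin d → ℕ) : ℕ := ∏ i, Nat.factorial (α i)

/-- The set of quotients defining the norm of `E^{M_p,ℓ}(K)`. -/
def ESet (M : ℕ → ℝ) (ℓ : ℝ) (K : Set (Rd d)) (φ : Rd d → ℂ) : Set ℝ :=
  {r | ∃ (α : Fin d → ℕ) (x : Rd d), x ∈ K ∧
    r = ‖mderiv α φ x‖ / (ℓ ^ mOrd α * M (mOrd α))}

/-- `‖φ‖_{E^{M_p,ℓ}(K)}`. -/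
def Enorm (M : ℕ → ℝ) (ℓ : ℝ) (K : Set (Rd d)) (φ : Rd d → ℂ) : ℝ :=
  sSup (ESet M ℓ K φ)

/-- Finiteness of `‖φ‖_{E^{M_p,ℓ}(K)}`. -/
def EnormFin (M : ℕ → ℝ) (ℓ : ℝ) (K : Set (Rd d)) (φ : Rd d → ℂ) : Prop :=
  BddAbove (ESet M ℓ K φ)

/-- Membership in the test space `D^{(M_p)}(ℝ^d)`. -/
def IsTestD (M : ℕ → ℝ) (φ : Rd d → ℂ) : Prop :=
  ContDiff ℝ (⊤ : ℕ∞) φ ∧ HasCompactSupport φ ∧ ∀ ℓ > (0 : ℝ), EnormFin M ℓ (tsupport φ) φ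

/-- `f` is a Beurling ultradistribution of class `(M_p)`. -/
def IsUltraD (M : ℕ → ℝ) (f : (Rd d → ℂ) →ₗ[ℂ] ℂ) : Prop :=
  ∀ K : Set (Rd d), IsCompact K → ∃ ℓ > (0 : ℝ), ∃ C > (0 : ℝ), ∀ φ : Rd d → ℂ,
    IsTestD M φ → tsupport φ ⊆ K → ‖f φ‖ ≤ C * Enorm M ℓ K φ

/-- Euclidean dot product. -/
def dotR (ξ t : Rd d) : ℝ := ∑ i, ξ i * t i

/-- The window `t ↦ conj(ψ(t-x)) e^{-2πi ξ·t}` of the short-time Fourier transform. -/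
def windowFn (ψ : Rd d → ℂ) (x ξ : Rd d) : Rd d → ℂ :=
  fun t => (starRingEnd ℂ) (ψ (t - x)) * Complex.exp (-(2 * Real.pi * dotR ξ t : ℝ) * Complex.I)

/-- The short-time Fourier transform of a function `φ` with respect to the window `ψ`. -/
def STFTf (ψ φ : Rd d → ℂ) (x ξ : Rd d) : ℂ := ∫ t, φ t * windowFn ψ x ξ t

/-- The short-time Fourier transform of a linear functional `f` w.r.t. the window `ψ`. -/
def STFTd (f : (Rd d → ℂ) →ₗ[ℂ] ℂ) (ψ : Rd d → ℂ) (x ξ : Rd d) : ℂ := f (windowFn ψ x ξ)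

/-- The weight condition (5): `ω(·+x)/ω(x)` locally uniformly bounded. -/
def OmegaCond (ω : Rd d → ℝ) : Prop :=
  (∀ x, 0 < ω x) ∧ Measurable ω ∧
    ∀ R > (0 : ℝ), ∃ C > (0 : ℝ), ∀ x h : Rd d, ‖h‖ ≤ R → ω (x + h) ≤ C * ω x

/-- The derivative of `f` in the direction `v`. -/
def dirDeriv (v : Rd d) (f : Rd d → ℂ) : Rd d → ℂ := fun x => fderiv ℝ f x v

/-! ### Iterates and folds of families of operators -/

theorem iterate_semiconj {X Y : Type*} {U : X → Prop} {N : X → X} {N' : Y → Y} {G : X → Y}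
    (hU : ∀ x, U x → U (N x)) (hG : ∀ x, U x → N' (G x) = G (N x)) (n : ℕ) :
    ∀ x, U x → N'^[n] (G x) = G (N^[n] x) := by
  induction n with
  | zero => intro x _; rfl
  | succ n ih =>
    intro x hx
    rw [Function.iterate_succ_apply, hG x hx, ih _ (hU x hx), Function.iterate_succ_apply]

theorem iterate_count {X : Type*} {Q : ℕ → X → Prop} {N : X → X}
    (hQ : ∀ n x, Q n x → Q (n + 1) (N x)) (m : ℕ) {n : ℕ} {x : X} (hx : Q n x) :
    Q (n + m) (N^[m] x) := by
  induction m with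
  | zero => exact hx
  | succ m ih =>
    rw [Function.iterate_succ_apply']
    exact hQ _ _ ih

theorem foldr_count {ι X : Type*} {Q : ℕ → X → Prop} {N : ι → X → X} (α : ι → ℕ)
    (hQ : ∀ i n x, Q n x → Q (n + 1) (N i x)) {n : ℕ} {x : X} (hx : Q n x) (l : List ι) :
    Q (n + (l.map α).sum) (l.foldr (fun i g => (N i)^[α i] g) x) := by
  induction l with
  | nil => simpa using hx
  | cons i l ih =>
    have := iterate_count (hQ i) (α i) ih
    rw [List.map_cons, List.sum_cons, List.foldr_cons, add_comm (α i), ← add_assoc]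
    exact this

theorem foldr_invariant {ι X : Type*} {U : X → Prop} {N : ι → X → X} (α : ι → ℕ)
    (hU : ∀ i x, U x → U (N i x)) {x : X} (hx : U x) (l : List ι) :
    U (l.foldr (fun i g => (N i)^[α i] g) x) :=
  foldr_count (Q := fun _ => U) (n := 0) α (fun i _ x h => hU i x h) hx l

theorem foldr_semiconj {ι X Y : Type*} {U : X → Prop} {N : ι → X → X} {N' : ι → Y → Y}
    {G : X → Y} (α : ι → ℕ) (hU : ∀ i x, U x → U (N i x))
    (hG : ∀ i x, U x → N' i (G x) = G (N i x)) {x : X} (hx : U x) (l : List ι) :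
    l.foldr (fun i g => (N' i)^[α i] g) (G x) = G (l.foldr (fun i g => (N i)^[α i] g) x) := by
  induction l with
  | nil => rfl
  | cons i l ih =>
    rw [List.foldr_cons, List.foldr_cons, ih]
    exact iterate_semiconj (hU i) (hG i) (α i) _ (foldr_invariant α hU hx l)

theorem sum_map_finRange (α : Fin d → ℕ) : ((List.finRange d).map α).sum = mOrd α :=
  (Fin.sum_univ_def α).symm

/-! ### Directional and multi-index derivatives of smooth functions -/

theorem ContDiff.dirDeriv {f : Rd d → ℂ} (hf : ContDiff ℝ (⊤ : ℕ∞) f) (v : Rd d) :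
    ContDiff ℝ (⊤ : ℕ∞) (dirDeriv v f) :=
  (hf.fderiv_right (m := (⊤ : ℕ∞)) (by norm_cast)).clm_apply contDiff_const

theorem ContDiff.dirDeriv_iterate {f : Rd d → ℂ} (hf : ContDiff ℝ (⊤ : ℕ∞) f) (v : Rd d)
    (n : ℕ) : ContDiff ℝ (⊤ : ℕ∞) ((_root_.dirDeriv v)^[n] f) :=
  iterate_count (Q := fun _ => ContDiff ℝ (⊤ : ℕ∞)) (n := 0) (fun _ _ h => h.dirDeriv v) n hf

theorem tsupport_dirDeriv_subset (v : Rd d) (f : Rd d → ℂ) :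
    tsupport (dirDeriv v f) ⊆ tsupport f := by
  refine closure_minimal (fun x hx => ?_) (isClosed_tsupport f)
  by_contra h
  refine hx ?_
  simp [dirDeriv, fderiv_of_notMem_tsupport ℝ h]

theorem tsupport_dirDeriv_iterate_subset (v : Rd d) (f : Rd d → ℂ) (n : ℕ) :
    tsupport ((dirDeriv v)^[n] f) ⊆ tsupport f :=
  iterate_count (Q := fun _ g => tsupport g ⊆ tsupport f) (n := 0)
    (fun _ _ h => (tsupport_dirDeriv_subset v _).trans h) n subset_rfl

theorem dirDeriv_comm {f : Rd d → ℂ} (hf : ContDiff ℝ (⊤ : ℕ∞) f) (v w : Rd d) :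
    dirDeriv v (dirDeriv w f) = dirDeriv w (dirDeriv v f) := by
  have key : ∀ a b x, dirDeriv a (dirDeriv b f) x = fderiv ℝ (fderiv ℝ f) x a b := by
    intro a b x
    have hd : DifferentiableAt ℝ (fderiv ℝ f) x :=
      ((hf.fderiv_right (m := (⊤ : ℕ∞)) (by norm_cast)).differentiable (by simp)) x
    change fderiv ℝ (fun y => fderiv ℝ f y b) x a = _
    rw [fderiv_clm_apply hd (differentiableAt_const b)]
    simp
  funext x
  rw [key, key]
  exact (hf.contDiffAt.isSymmSndFDerivAt (by simp; norm_cast)) v w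

theorem dirDeriv_neg (v : Rd d) (f : Rd d → ℂ) : dirDeriv v (-f) = -dirDeriv v f := by
  funext x
  simp [dirDeriv, fderiv_neg]

theorem dirDeriv_iterate_add {f g : Rd d → ℂ} (hf : ContDiff ℝ (⊤ : ℕ∞) f)
    (hg : ContDiff ℝ (⊤ : ℕ∞) g) (v : Rd d) (n : ℕ) :
    (dirDeriv v)^[n] (f + g) = (dirDeriv v)^[n] f + (dirDeriv v)^[n] g := by
  refine iterate_semiconj
    (U := fun p : (Rd d → ℂ) × (Rd d → ℂ) => ContDiff ℝ (⊤ : ℕ∞) p.1 ∧ ContDiff ℝ (⊤ : ℕ∞) p.2)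
    (N := Prod.map (dirDeriv v) (dirDeriv v)) (N' := dirDeriv v) (G := fun p => p.1 + p.2)
    (fun p hp => ⟨hp.1.dirDeriv v, hp.2.dirDeriv v⟩) (fun p hp => ?_) n (f, g) ⟨hf, hg⟩
    |>.trans ?_
  · funext x
    simp [dirDeriv, fderiv_add (hp.1.differentiable (by simp) x) (hp.2.differentiable (by simp) x)]
  · simp [Prod.map_iterate]

theorem dirDeriv_mul {f g : Rd d → ℂ} (hf : ContDiff ℝ (⊤ : ℕ∞) f)
    (hg : ContDiff ℝ (⊤ : ℕ∞) g) (v : Rd d) :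
    dirDeriv v (f * g) = dirDeriv v f * g + f * dirDeriv v g := by
  funext x
  simp only [dirDeriv, Pi.add_apply, Pi.mul_apply]
  rw [fderiv_mul (hf.differentiable (by simp) x) (hg.differentiable (by simp) x)]
  simp
  ring

theorem mderiv_zero (f : Rd d → ℂ) : mderiv 0 f = f := by
  simp [mderiv]

theorem mderiv_neg (γ : Fin d → ℕ) (f : Rd d → ℂ) : mderiv γ (-f) = -mderiv γ f :=
  foldr_semiconj (U := fun _ => True) (G := fun f : Rd d → ℂ => -f) γ (fun _ _ _ => trivial)
    (fun _ f _ => dirDeriv_neg _ f) trivial _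

theorem mderiv_pder {f : Rd d → ℂ} (hf : ContDiff ℝ (⊤ : ℕ∞) f) (γ : Fin d → ℕ) (j : Fin d) :
    mderiv γ (pder j f) = pder j (mderiv γ f) :=
  foldr_semiconj (U := ContDiff ℝ (⊤ : ℕ∞)) γ (fun _ _ h => h.dirDeriv _)
    (fun _ _ h => dirDeriv_comm h _ _) hf _

theorem mderiv_add_single {f : Rd d → ℂ} (hf : ContDiff ℝ (⊤ : ℕ∞) f) (γ : Fin d → ℕ)
    (j : Fin d) : mderiv (γ + Pi.single j 1) f = pder j (mderiv γ f) := by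
  have key : ∀ l : List (Fin d), l.Nodup →
      l.foldr (fun i g => (pder i)^[(γ + Pi.single j 1 : Fin d → ℕ) i] g) f =
        if j ∈ l then pder j (l.foldr (fun i g => (pder i)^[γ i] g) f)
        else l.foldr (fun i g => (pder i)^[γ i] g) f := by
    intro l
    induction l with
    | nil => intro _; simp
    | cons i l ih =>
      intro hl
      rw [List.nodup_cons] at hl
      rw [List.foldr_cons, List.foldr_cons, ih hl.2]
      by_cases hij : j = i
      · subst hij
        simp [hl.1, Function.iterate_succ_apply']
      · by_cases hjl : j ∈ l
        · simp only [hjl, if_true, List.mem_cons, or_true, Pi.add_apply,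
            Pi.single_eq_of_ne' hij, add_zero]
          exact iterate_semiconj (U := ContDiff ℝ (⊤ : ℕ∞)) (fun _ h => h.dirDeriv _)
            (fun _ h => dirDeriv_comm h _ _) _ _
            (foldr_invariant γ (fun _ _ h => h.dirDeriv _) hf l)
        · simp [hjl, hij]
  have := key _ (List.nodup_finRange d)
  rwa [if_pos (List.mem_finRange j)] at this

theorem mderiv_single {f : Rd d → ℂ} (hf : ContDiff ℝ (⊤ : ℕ∞) f) (i : Fin d) (n : ℕ) :
    mderiv (Pi.single i n) f = (pder i)^[n] f := by
  induction n with
  | zero => rw [Pi.single_zero, mderiv_zero]; rfl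
  | succ n ih => rw [Pi.single_add, mderiv_add_single hf, ih, Function.iterate_succ_apply']

theorem mOrd_single (i : Fin d) (n : ℕ) : mOrd (Pi.single i n) = n := by
  simp [mOrd]

theorem mOrd_add (α β : Fin d → ℕ) : mOrd (α + β) = mOrd α + mOrd β := by
  simp [mOrd, Finset.sum_add_distrib]

/-! ### Weight sequences -/

theorem IsM1.mul_le {M : ℕ → ℝ} (hM : IsM1 M) (a b : ℕ) : M a * M b ≤ M 0 * M (a + b) := by
  have hpos := hM.1
  have hmono : Monotone fun p => M (p + 1) / M p := by
    refine monotone_nat_of_le_succ fun p => ?_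
    rw [div_le_div_iff₀ (hpos _) (hpos _)]
    have := hM.2 (p + 1) (by omega)
    rw [Nat.add_sub_cancel] at this
    nlinarith
  induction b with
  | zero => rw [mul_comm, add_zero]
  | succ b ih =>
    have h1 : M (b + 1) = M b * (M (b + 1) / M b) := by field_simp [(hpos b).ne']
    have h2 : M (a + (b + 1)) = M (a + b) * (M (a + b + 1) / M (a + b)) := by
      rw [← add_assoc]; field_simp [(hpos (a + b)).ne']
    rw [h1, h2, ← mul_assoc, ← mul_assoc]
    exact mul_le_mul ih (hmono (Nat.le_add_left b a)) (div_pos (hpos _) (hpos _)).le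
      (mul_pos (hpos _) (hpos _)).le

/-! ### Bounds on iterated directional derivatives -/

/-- The iterated derivatives of `f` in the direction `v` are bounded on `K` by
`c * h ^ n * M (a + n)`. -/
def DirBound (M : ℕ → ℝ) (v : Rd d) (K : Set (Rd d)) (h c : ℝ) (a : ℕ) (f : Rd d → ℂ) : Prop :=
  ∀ n, ∀ t ∈ K, ‖(dirDeriv v)^[n] f t‖ ≤ c * h ^ n * M (a + n)

theorem DirBound.dirDeriv {M : ℕ → ℝ} {v : Rd d} {K : Set (Rd d)} {h c : ℝ} {a : ℕ}
    {f : Rd d → ℂ} (hf : DirBound M v K h c a f) :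
    DirBound M v K h (c * h) (a + 1) (dirDeriv v f) := by
  intro n t ht
  have := hf (n + 1) t ht
  rw [Function.iterate_succ_apply] at this
  refine this.trans_eq ?_
  rw [pow_succ', show a + (n + 1) = a + 1 + n by omega]
  ring

theorem DirBound.mul {M : ℕ → ℝ} (hM : IsM1 M) {v : Rd d} {K : Set (Rd d)} {h₁ h₂ : ℝ}
    (hh₁ : 0 ≤ h₁) (hh₂ : 0 ≤ h₂) {c₁ c₂ : ℝ} (hc₁ : 0 ≤ c₁) (hc₂ : 0 ≤ c₂) {a b : ℕ}
    {f g : Rd d → ℂ} (hf : ContDiff ℝ (⊤ : ℕ∞) f) (hg : ContDiff ℝ (⊤ : ℕ∞) g)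
    (hfb : DirBound M v K h₁ c₁ a f) (hgb : DirBound M v K h₂ c₂ b g) :
    DirBound M v K (h₁ + h₂) (c₁ * c₂ * M 0) (a + b) (f * g) := by
  intro n
  induction n generalizing c₁ c₂ a b f g with
  | zero =>
    intro t ht
    have h1 := hfb 0 t ht
    have h2 := hgb 0 t ht
    simp only [Function.iterate_zero, id_eq, pow_zero, mul_one, add_zero] at h1 h2 ⊢
    rw [Pi.mul_apply, norm_mul]
    calc ‖f t‖ * ‖g t‖ ≤ (c₁ * M a) * (c₂ * M b) :=
          mul_le_mul h1 h2 (norm_nonneg _) (mul_nonneg hc₁ (hM.1 a).le)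
      _ = c₁ * c₂ * (M a * M b) := by ring
      _ ≤ c₁ * c₂ * (M 0 * M (a + b)) :=
          mul_le_mul_of_nonneg_left (hM.mul_le a b) (mul_nonneg hc₁ hc₂)
      _ = _ := by ring
  | succ n ih =>
    intro t ht
    have hf' := hf.dirDeriv v
    have hg' := hg.dirDeriv v
    rw [Function.iterate_succ_apply, dirDeriv_mul hf hg,
      dirDeriv_iterate_add (f := _root_.dirDeriv v f * g) (g := f * _root_.dirDeriv v g)
        (hf'.mul hg) (hf.mul hg'), Pi.add_apply]
    have h1 := ih (mul_nonneg hc₁ hh₁) hc₂ hf' hg hfb.dirDeriv hgb t ht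
    have h2 := ih hc₁ (mul_nonneg hc₂ hh₂) hf hg' hfb hgb.dirDeriv t ht
    rw [show a + 1 + b + n = a + b + (n + 1) by omega] at h1
    rw [show a + (b + 1) + n = a + b + (n + 1) by omega] at h2
    refine (norm_add_le _ _).trans ((add_le_add h1 h2).trans_eq ?_)
    ring

theorem dirDeriv_iterate_zero_dir (f : Rd d → ℂ) (n : ℕ) (hn : n ≠ 0) :
    (dirDeriv 0)^[n] f = 0 := by
  obtain ⟨m, rfl⟩ := Nat.exists_eq_succ_of_ne_zero hn
  rw [Function.iterate_succ_apply']
  funext x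
  simp [dirDeriv]

/-- The multiplier `t ↦ -2πi t_j`. -/
def coordMul (j : Fin d) : Rd d → ℂ := fun t => -(2 * π * Complex.I) * (t j : ℂ)

theorem contDiff_coordMul (j : Fin d) : ContDiff ℝ (⊤ : ℕ∞) (coordMul j) := by
  unfold coordMul
  refine contDiff_const.mul (Complex.ofRealCLM.contDiff.comp ?_)
  exact (EuclideanSpace.proj (𝕜 := ℝ) j).contDiff

theorem dirDeriv_coordMul (v : Rd d) (j : Fin d) :
    dirDeriv v (coordMul j) = fun _ => coordMul j v := by
  funext x
  have h := ((Complex.ofRealCLM.comp (EuclideanSpace.proj (𝕜 := ℝ) j) : Rd d →L[ℝ] ℂ).hasFDerivAt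
    (x := x)).const_smul (-(2 * π * Complex.I))
  have h' : HasFDerivAt (coordMul j) _ x := h
  simp only [dirDeriv]
  rw [h'.fderiv]
  simp [coordMul]

theorem dirBound_coordMul {M : ℕ → ℝ} (hM : IsM1 M) (R : ℝ) {h : ℝ} (hh : 0 < h) :
    ∃ c > (0 : ℝ), ∀ (v : Rd d), ‖v‖ ≤ 1 → ∀ j,
      DirBound M v (Metric.closedBall 0 R) h c 0 (coordMul j) := by
  have hnorm : ∀ (j : Fin d) (t : Rd d), ‖coordMul j t‖ ≤ 2 * π * ‖t‖ := by
    intro j t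
    have : ‖coordMul j t‖ = 2 * π * ‖t j‖ := by
      simp [coordMul, abs_of_pos Real.pi_pos]
    rw [this]
    exact mul_le_mul_of_nonneg_left (PiLp.norm_apply_le t j) (by positivity)
  have hM0 := hM.1 0
  have hM1 := hM.1 1
  refine ⟨2 * π * |R| / M 0 + 2 * π / (h * M 1), by positivity, fun v hv j n t ht => ?_⟩
  have hc : 0 ≤ 2 * π * |R| / M 0 := by positivity
  have hc' : 0 ≤ 2 * π / (h * M 1) := by positivity
  rw [zero_add]
  match n with
  | 0 =>
    have ht' : ‖t‖ ≤ |R| := (mem_closedBall_zero_iff.1 ht).trans (le_abs_self R)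
    calc ‖coordMul j t‖ ≤ 2 * π * |R| := (hnorm j t).trans (by gcongr)
      _ = (2 * π * |R| / M 0) * h ^ 0 * M 0 := by field_simp
      _ ≤ _ := by gcongr; linarith
  | 1 =>
    rw [Function.iterate_one, dirDeriv_coordMul]
    calc ‖coordMul j v‖ ≤ 2 * π * 1 := (hnorm j v).trans (by gcongr)
      _ = (2 * π / (h * M 1)) * h ^ 1 * M 1 := by field_simp
      _ ≤ _ := by gcongr; linarith
  | n + 2 =>
    rw [Function.iterate_add_apply, Function.iterate_succ_apply, Function.iterate_one,
      dirDeriv_coordMul]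
    have h0 : dirDeriv v (fun _ : Rd d => coordMul j v) = 0 := by
      funext x; simp [dirDeriv]
    have h1 : (dirDeriv v)^[n] (0 : Rd d → ℂ) = 0 := by
      refine Function.iterate_fixed ?_ n
      funext x; simp [dirDeriv]
    rw [h0, h1]
    have := hM.1 (n + 2)
    simp only [Pi.zero_apply, norm_zero]
    positivity

theorem dirDeriv_conj_sub {f : Rd d → ℂ} (v x : Rd d) :
    dirDeriv v (fun t => (starRingEnd ℂ) (f (t - x))) =
      fun t => (starRingEnd ℂ) (dirDeriv v f (t - x)) := by
  funext t
  have : (fun t => (starRingEnd ℂ) (f (t - x))) =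
      (Complex.conjCLE : ℂ → ℂ) ∘ fun t => f (t - x) := rfl
  simp only [dirDeriv]
  rw [this, ContinuousLinearEquiv.comp_fderiv, fderiv_comp_sub]
  simp

theorem dirDeriv_iterate_conj_sub {f : Rd d → ℂ} (v x : Rd d) (n : ℕ) :
    (dirDeriv v)^[n] (fun t => (starRingEnd ℂ) (f (t - x))) =
      fun t => (starRingEnd ℂ) ((dirDeriv v)^[n] f (t - x)) :=
  iterate_semiconj (U := fun _ => True)
    (G := fun (f : Rd d → ℂ) (t : Rd d) => (starRingEnd ℂ) (f (t - x)))
    (fun _ _ => trivial) (fun _ _ => dirDeriv_conj_sub v x) n f trivial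

theorem DirBound.of_mderiv {M : ℕ → ℝ} {K : Set (Rd d)} {h c : ℝ} (hM : IsM1 M) (hh : 0 ≤ h)
    (hc : 0 ≤ c)
    {f : Rd d → ℂ} (hf : ContDiff ℝ (⊤ : ℕ∞) f)
    (hb : ∀ γ, ∀ t ∈ K, ‖mderiv γ f t‖ ≤ c * (h ^ mOrd γ * M (mOrd γ)))
    {v : Rd d} (hv : v = 0 ∨ ∃ i, v = EuclideanSpace.single i 1) :
    DirBound M v K h c 0 f := by
  intro n t ht
  rw [zero_add, mul_assoc]
  rcases hv with rfl | ⟨i, rfl⟩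
  · rcases eq_or_ne n 0 with rfl | hn
    · simpa [mderiv_zero, mOrd] using hb 0 t ht
    · rw [dirDeriv_iterate_zero_dir f n hn]
      have := hM.1 n
      simp only [Pi.zero_apply, norm_zero]
      positivity
  · have := hb (Pi.single i n) t ht
    rwa [mderiv_single hf, mOrd_single] at this

theorem norm_mderiv_le_Enorm {M : ℕ → ℝ} (hM : IsM1 M) {h : ℝ} (hh : 0 < h) {K : Set (Rd d)}
    {f : Rd d → ℂ} (hf : EnormFin M h K f) (γ : Fin d → ℕ) {t : Rd d} (ht : t ∈ K) :
    ‖mderiv γ f t‖ ≤ Enorm M h K f * (h ^ mOrd γ * M (mOrd γ)) := by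
  have := hM.1 (mOrd γ)
  rw [← div_le_iff₀ (by positivity)]
  exact le_csSup hf ⟨γ, t, ht, rfl⟩

theorem Enorm_nonneg {M : ℕ → ℝ} (hM : IsM1 M) {h : ℝ} (hh : 0 < h) (K : Set (Rd d))
    (f : Rd d → ℂ) : 0 ≤ Enorm M h K f := by
  refine Real.sSup_nonneg ?_
  rintro _ ⟨γ, t, -, rfl⟩
  have := hM.1 (mOrd γ)
  positivity

theorem EnormFin.pder {M : ℕ → ℝ} (hM : IsM1 M) {A H : ℝ} (hH : 1 ≤ H)
    (hM2 : ∀ p : ℕ, M (p + 1) ≤ A * H ^ p * M p) {f : Rd d → ℂ} (hf : ContDiff ℝ (⊤ : ℕ∞) f)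
    (hb : ∀ h > (0 : ℝ), EnormFin M h Set.univ f) (j : Fin d) :
    ∀ h > (0 : ℝ), EnormFin M h Set.univ (pder j f) := by
  intro h hh
  have hH0 : 0 < H := by linarith
  have hh' : 0 < h / H := by positivity
  set E := Enorm M (h / H) Set.univ f with hE
  have hE0 : 0 ≤ E := Enorm_nonneg hM hh' _ _
  refine ⟨E * (h / H) * A, ?_⟩
  rintro _ ⟨γ, t, ht, rfl⟩
  have hMp := hM.1 (mOrd γ)
  rw [div_le_iff₀ (by positivity), mderiv_pder hf, ← mderiv_add_single hf]
  refine (norm_mderiv_le_Enorm hM hh' (hb _ hh') _ ht).trans ?_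
  rw [mOrd_add, mOrd_single, ← hE]
  calc E * ((h / H) ^ (mOrd γ + 1) * M (mOrd γ + 1))
      ≤ E * ((h / H) ^ (mOrd γ + 1) * (A * H ^ mOrd γ * M (mOrd γ))) := by
        gcongr; exact hM2 _
    _ = E * (h / H) * A * (h ^ mOrd γ * M (mOrd γ)) := by
        rw [pow_succ, div_pow]; field_simp

/-! ### The short-time Fourier transform -/

open FourierTransform in
theorem STFTf_eq_fourier (ψ φ : Rd d → ℂ) (x ξ : Rd d) :
    STFTf ψ φ x ξ = 𝓕 (φ * fun t => (starRingEnd ℂ) (ψ (t - x))) ξ := by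
  rw [Real.fourier_eq']
  refine integral_congr_ae (Filter.Eventually.of_forall fun t => ?_)
  have : dotR ξ t = inner ℝ t ξ := by
    simp [dotR, PiLp.inner_apply]
  simp only [windowFn, this, smul_eq_mul, Pi.mul_apply]
  push_cast
  ring_nf

theorem contDiff_conj_sub {ψ : Rd d → ℂ} (hψ : ContDiff ℝ (⊤ : ℕ∞) ψ) (x : Rd d) :
    ContDiff ℝ (⊤ : ℕ∞) fun t => (starRingEnd ℂ) (ψ (t - x)) :=
  Complex.conjCLE.contDiff.comp (hψ.comp (contDiff_id.sub contDiff_const))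

theorem pder_STFTf_freq {ψ φ : Rd d → ℂ} (hψ : ContDiff ℝ (⊤ : ℕ∞) ψ)
    (hφ : ContDiff ℝ (⊤ : ℕ∞) φ) (hφc : HasCompactSupport φ) (x : Rd d) (j : Fin d) :
    pder j (STFTf ψ φ x) = STFTf ψ (coordMul j * φ) x := by
  set F : Rd d → ℂ := φ * fun t => (starRingEnd ℂ) (ψ (t - x)) with hF
  have hFs : Continuous F := hφ.continuous.mul (contDiff_conj_sub hψ x).continuous
  have hFc : HasCompactSupport F := hφc.mul_right
  have hint : Integrable F := hFs.integrable_of_hasCompactSupport hFc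
  have hint' : Integrable fun t => ‖t‖ * ‖F t‖ :=
    (continuous_norm.mul hFs.norm).integrable_of_hasCompactSupport hFc.norm.mul_left
  funext ξ
  have h1 : STFTf ψ φ x = FourierTransform.fourier F := by
    funext ξ; exact STFTf_eq_fourier ψ φ x ξ
  simp only [pder]
  rw [h1, Real.fderiv_fourier hint hint', Real.fourier_continuousLinearMap_apply, STFTf_eq_fourier]
  · refine congrArg (fun u : Rd d → ℂ => FourierTransform.fourier u ξ) ?_
    funext t
    simp [VectorFourier.fourierSMulRight_apply, hF, coordMul, innerSL_apply_apply ℝ,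
      EuclideanSpace.inner_single_right]
    ring
  · refine (hint'.const_mul (2 * π * ‖innerSL ℝ (E := Rd d)‖)).mono'
      (hint.aestronglyMeasurable.fourierSMulRight (L := innerSL ℝ))
      (Filter.Eventually.of_forall fun t => ?_)
    exact (VectorFourier.norm_fourierSMulRight_le _ _ _).trans_eq (by ring)

theorem pder_STFTf_time {ψ φ : Rd d → ℂ} (hψ : ContDiff ℝ (⊤ : ℕ∞) ψ)
    (hψc : HasCompactSupport ψ) (hφ : Continuous φ) (ξ : Rd d) (j : Fin d) :
    pder j (fun x => STFTf ψ φ x ξ) = fun x => STFTf (-pder j ψ) φ x ξ := by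
  set f : Rd d → ℂ := fun t => φ t * Complex.exp (-(2 * π * dotR ξ t : ℝ) * Complex.I) with hf
  set g : Rd d → ℂ := fun y => (starRingEnd ℂ) (ψ (-y)) with hg
  have hfc : Continuous f := by
    refine hφ.mul (Complex.continuous_exp.comp ?_)
    unfold dotR
    fun_prop
  have hgs : ContDiff ℝ (⊤ : ℕ∞) g := Complex.conjCLE.contDiff.comp (hψ.comp contDiff_neg)
  have hgc : HasCompactSupport g :=
    (hψc.comp_homeomorph (Homeomorph.neg (Rd d))).comp_left (g := starRingEnd ℂ) (map_zero _)
  have hconv : (fun x => STFTf ψ φ x ξ) =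
      MeasureTheory.convolution f g (ContinuousLinearMap.mul ℝ ℂ) volume := by
    funext x
    simp only [STFTf, MeasureTheory.convolution, windowFn, hf, hg, neg_sub,
      ContinuousLinearMap.mul_apply']
    congr 1; funext t; ring
  funext x
  have hd := hgc.hasFDerivAt_convolution_right (ContinuousLinearMap.mul ℝ ℂ)
    (hfc.locallyIntegrable (μ := volume)) (hgs.of_le (by simp)) x
  have hgd : ∀ y v, fderiv ℝ g y v = -(starRingEnd ℂ) (fderiv ℝ ψ (-y) v) := by
    intro y v
    have h1 : HasFDerivAt ψ (fderiv ℝ ψ (-y)) (-y) :=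
      (hψ.differentiable (by simp) _).hasFDerivAt
    have h2 : HasFDerivAt g _ y :=
      (Complex.conjCLE.hasFDerivAt).comp y (h1.comp y (hasFDerivAt_id y).neg)
    rw [h2.fderiv]
    simp
  have hint : Integrable (fun t => ((ContinuousLinearMap.mul ℝ ℂ).precompR (Rd d)) (f t)
      (fderiv ℝ g (x - t))) := by
    refine Continuous.integrable_of_hasCompactSupport ?_ ?_
    · have : Continuous (fderiv ℝ g) := hgs.continuous_fderiv (by simp)
      fun_prop
    · have h1 : HasCompactSupport fun t => fderiv ℝ g (x - t) :=
        (hgc.fderiv ℝ).comp_homeomorph (Homeomorph.subLeft x)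
      refine h1.mono fun t ht h0 => ht ?_
      simp [h0]
  simp only [pder]
  rw [hconv, hd.fderiv, MeasureTheory.convolution, ContinuousLinearMap.integral_apply hint]
  simp only [STFTf]
  congr 1
  funext t
  change f t * fderiv ℝ g (x - t) _ = _
  rw [hgd]
  simp [windowFn, hf, pder]
  ring

open FourierTransform in
theorem fourier_dirDeriv {F : Rd d → ℂ} (hF : ContDiff ℝ (⊤ : ℕ∞) F) (hFc : HasCompactSupport F)
    (v ξ : Rd d) : 𝓕 (dirDeriv v F) ξ = 2 * π * Complex.I * (inner ℝ ξ v : ℝ) * 𝓕 F ξ := by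
  have hint : Integrable F := hF.continuous.integrable_of_hasCompactSupport hFc
  have hint' : Integrable (fderiv ℝ F) :=
    (hF.continuous_fderiv (by simp)).integrable_of_hasCompactSupport (hFc.fderiv ℝ)
  have h := Real.fourier_fderiv hint (hF.differentiable (by simp)) hint'
  have h2 := Real.fourier_continuousLinearMap_apply (a := v) (v := ξ) hint'
  rw [h] at h2
  rw [show dirDeriv v F = fun x => fderiv ℝ F x v from rfl, ← h2]
  simp only [VectorFourier.fourierSMulRight_apply, neg_apply,
    innerSL_apply_apply ℝ, neg_smul, smul_eq_mul, Complex.real_smul]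
  ring

open FourierTransform in
theorem fourier_dirDeriv_iterate {F : Rd d → ℂ} (hF : ContDiff ℝ (⊤ : ℕ∞) F)
    (hFc : HasCompactSupport F) (v ξ : Rd d) (n : ℕ) :
    𝓕 ((dirDeriv v)^[n] F) ξ = (2 * π * Complex.I * (inner ℝ ξ v : ℝ)) ^ n * 𝓕 F ξ := by
  induction n with
  | zero => simp
  | succ n ih =>
    rw [Function.iterate_succ_apply', fourier_dirDeriv (hF.dirDeriv_iterate v n)
      (hFc.of_isClosed_subset (isClosed_tsupport _) (tsupport_dirDeriv_iterate_subset v F n)), ih]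
    ring

open FourierTransform in
theorem norm_fourier_mul_pow_le {M : ℕ → ℝ} {F : Rd d → ℂ}
    (hF : ContDiff ℝ (⊤ : ℕ∞) F) (hFc : HasCompactSupport F) {R : ℝ}
    (hFR : tsupport F ⊆ Metric.closedBall 0 R) {v : Rd d} {h c : ℝ}
    (hb : DirBound M v (Metric.closedBall 0 R) h c 0 F) (ξ : Rd d) (n : ℕ) :
    (2 * π * |inner ℝ ξ v|) ^ n * ‖𝓕 F ξ‖ ≤
      c * h ^ n * M n * volume.real (Metric.closedBall (0 : Rd d) R) := by
  have h1 : (2 * π * |inner ℝ ξ v|) ^ n * ‖𝓕 F ξ‖ = ‖𝓕 ((dirDeriv v)^[n] F) ξ‖ := by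
    rw [fourier_dirDeriv_iterate hF hFc, norm_mul, norm_pow]
    simp [abs_of_pos Real.pi_pos]
  rw [h1]
  refine (VectorFourier.norm_fourierIntegral_le_integral_norm _ _ _ _ _).trans ?_
  have hsupp : ∀ t, t ∉ Metric.closedBall (0 : Rd d) R → ‖(dirDeriv v)^[n] F t‖ = 0 := by
    intro t ht
    rw [norm_eq_zero]
    by_contra h0
    exact ht (hFR (tsupport_dirDeriv_iterate_subset v F n (subset_tsupport _ h0)))
  rw [← setIntegral_eq_integral_of_forall_compl_eq_zero hsupp]
  refine (Real.le_norm_self _).trans ?_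
  refine norm_setIntegral_le_of_norm_le_const (measure_closedBall_lt_top) fun t ht => ?_
  rw [norm_norm]
  simpa using hb n t ht

theorem STFTf_eq_zero {ψ φ : Rd d → ℂ} {R₀ R : ℝ} (hR : R₀ < R)
    (hψ : tsupport ψ ⊆ Metric.closedBall 0 R₀) (hφ : tsupport φ ⊆ Metric.closedBall 0 R)
    {x : Rd d} (hx : 2 * R < ‖x‖) (ξ : Rd d) : STFTf ψ φ x ξ = 0 := by
  refine integral_eq_zero_of_ae (Filter.Eventually.of_forall fun t => ?_)
  by_cases ht : φ t = 0
  · simp [ht]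
  · have h1 : ‖t‖ ≤ R := mem_closedBall_zero_iff.1 (hφ (subset_tsupport _ ht))
    have h2 : ψ (t - x) = 0 := by
      by_contra h
      have h3 : ‖t - x‖ ≤ R₀ := mem_closedBall_zero_iff.1 (hψ (subset_tsupport _ h))
      have h4 : ‖x‖ ≤ ‖t‖ + ‖t - x‖ := by
        rw [norm_sub_rev]; exact norm_le_norm_add_norm_sub' x t
      linarith
    simp [windowFn, h2]

/-- The window function obtained from `ψ` by differentiating `α` times in the time variable. -/
def timeWindow (α : Fin d → ℕ) (ψ : Rd d → ℂ) : Rd d → ℂ :=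
  (List.finRange d).foldr (fun i g => (fun f => -pder i f)^[α i] g) ψ

/-- The function `t ↦ (-2πi t)^β φ(t)`. -/
def freqMul (β : Fin d → ℕ) (φ : Rd d → ℂ) : Rd d → ℂ :=
  (List.finRange d).foldr (fun j g => (fun f => coordMul j * f)^[β j] g) φ

theorem mderiv_STFTf_time (α : Fin d → ℕ) {ψ φ : Rd d → ℂ} (hψ : ContDiff ℝ (⊤ : ℕ∞) ψ)
    (hψc : HasCompactSupport ψ) (hφ : Continuous φ) (ξ : Rd d) :
    mderiv α (fun x => STFTf ψ φ x ξ) = fun x => STFTf (timeWindow α ψ) φ x ξ :=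
  foldr_semiconj (U := fun ψ => ContDiff ℝ (⊤ : ℕ∞) ψ ∧ HasCompactSupport ψ)
    (N := fun i f => -pder i f) (G := fun ψ x => STFTf ψ φ x ξ) α
    (fun _ ψ h => ⟨(h.1.dirDeriv _).neg, HasCompactSupport.comp_left (g := Neg.neg)
      (IsCompact.of_isClosed_subset h.2 (isClosed_tsupport _) (tsupport_dirDeriv_subset _ ψ))
      neg_zero⟩)
    (fun i _ h => pder_STFTf_time h.1 h.2 hφ ξ i) ⟨hψ, hψc⟩ _

theorem mderiv_STFTf_freq (β : Fin d → ℕ) {ψ φ : Rd d → ℂ} (hψ : ContDiff ℝ (⊤ : ℕ∞) ψ)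
    (hφ : ContDiff ℝ (⊤ : ℕ∞) φ) (hφc : HasCompactSupport φ) (x : Rd d) :
    mderiv β (STFTf ψ φ x) = STFTf ψ (freqMul β φ) x :=
  foldr_semiconj (U := fun φ => ContDiff ℝ (⊤ : ℕ∞) φ ∧ HasCompactSupport φ)
    (N := fun j f => coordMul j * f) (G := fun φ => STFTf ψ φ x) β
    (fun j _ h => ⟨(contDiff_coordMul j).mul h.1, h.2.mul_left⟩)
    (fun i _ h => pder_STFTf_freq hψ h.1 h.2 x i) ⟨hφ, hφc⟩ _

theorem timeWindow_spec {M : ℕ → ℝ} (hM : IsM1 M) {A H : ℝ} (hH : 1 ≤ H)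
    (hM2 : ∀ p : ℕ, M (p + 1) ≤ A * H ^ p * M p) {ψ : Rd d → ℂ} (hψ : ContDiff ℝ (⊤ : ℕ∞) ψ)
    (hψb : ∀ h > (0 : ℝ), EnormFin M h Set.univ ψ) (α : Fin d → ℕ) :
    ContDiff ℝ (⊤ : ℕ∞) (timeWindow α ψ) ∧
      ∀ h > (0 : ℝ), EnormFin M h Set.univ (timeWindow α ψ) := by
  refine foldr_invariant (U := fun ψ => ContDiff ℝ (⊤ : ℕ∞) ψ ∧
    ∀ h > (0 : ℝ), EnormFin M h Set.univ ψ) (N := fun i f => -pder i f) α (fun i f h => ?_)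
    ⟨hψ, hψb⟩ _
  refine ⟨(h.1.dirDeriv _).neg, fun ℓ hℓ => ?_⟩
  have := EnormFin.pder hM hH hM2 h.1 h.2 i ℓ hℓ
  unfold EnormFin ESet at this ⊢
  simpa only [mderiv_neg, Pi.neg_apply, norm_neg] using this

theorem freqMul_spec {φ : Rd d → ℂ} {R : ℝ} (hφ : ContDiff ℝ (⊤ : ℕ∞) φ)
    (hφc : HasCompactSupport φ) (hφR : tsupport φ ⊆ Metric.closedBall 0 R) (β : Fin d → ℕ) :
    ContDiff ℝ (⊤ : ℕ∞) (freqMul β φ) ∧ HasCompactSupport (freqMul β φ) ∧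
      tsupport (freqMul β φ) ⊆ Metric.closedBall 0 R :=
  foldr_invariant (U := fun φ => ContDiff ℝ (⊤ : ℕ∞) φ ∧ HasCompactSupport φ ∧
      tsupport φ ⊆ Metric.closedBall 0 R) (N := fun j f => coordMul j * f) β
    (fun j _ h => ⟨(contDiff_coordMul j).mul h.1, h.2.1.mul_left,
      (tsupport_mul_subset_right).trans h.2.2⟩) ⟨hφ, hφc, hφR⟩ _

theorem dirBound_freqMul {M : ℕ → ℝ} (hM : IsM1 M) {v : Rd d} {K : Set (Rd d)} {s c₀ c : ℝ}
    (hs : 0 ≤ s) (hc₀ : 0 ≤ c₀) (hc : 0 ≤ c)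
    (hv : ∀ j, DirBound M v K s c₀ 0 (coordMul j)) {φ : Rd d → ℂ}
    (hφ : ContDiff ℝ (⊤ : ℕ∞) φ) (hb : DirBound M v K s c 0 φ) (β : Fin d → ℕ) :
    DirBound M v K (s + mOrd β * s) ((c₀ * M 0) ^ mOrd β * c) 0 (freqMul β φ) := by
  have hM0 := (hM.1 0).le
  have := foldr_count (Q := fun n φ => ContDiff ℝ (⊤ : ℕ∞) φ ∧
    DirBound M v K (s + n * s) ((c₀ * M 0) ^ n * c) 0 φ) (N := fun j f => coordMul j * f) (n := 0)
    (x := φ) β (fun j n φ h => ⟨(contDiff_coordMul j).mul h.1, ?_⟩)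
    ⟨hφ, by simpa using hb⟩ (List.finRange d)
  · rw [sum_map_finRange, zero_add] at this
    exact this.2
  · have := (hv j).mul hM hs (by positivity) hc₀ (by positivity) (contDiff_coordMul j) h.1 h.2
    convert this using 1
    · push_cast; ring
    · ring

theorem exists_dir_norm_le (ξ : Rd d) : ∃ v : Rd d,
    (v = 0 ∨ ∃ i, v = EuclideanSpace.single i 1) ∧ ‖ξ‖ ≤ √d * |inner ℝ ξ v| := by
  rcases isEmpty_or_nonempty (Fin d) with hd | hd
  · refine ⟨0, Or.inl rfl, ?_⟩
    have : ξ = 0 := Subsingleton.elim _ _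
    simp [this]
  · obtain ⟨i, hi⟩ := Finite.exists_max fun i => |ξ i|
    refine ⟨EuclideanSpace.single i 1, Or.inr ⟨i, rfl⟩, ?_⟩
    rw [EuclideanSpace.inner_single_right, EuclideanSpace.norm_eq]
    simp only [conj_trivial, one_mul]
    rw [← Real.sqrt_sq (abs_nonneg (ξ i)), ← Real.sqrt_mul (Nat.cast_nonneg d)]
    refine Real.sqrt_le_sqrt ?_
    calc ∑ j, ‖ξ j‖ ^ 2 ≤ ∑ _j : Fin d, |ξ i| ^ 2 :=
          Finset.sum_le_sum fun j _ => pow_le_pow_left₀ (norm_nonneg _) (hi j) 2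
      _ = d * |ξ i| ^ 2 := by simp

theorem norm_le_one_of_dir {v : Rd d} (hv : v = 0 ∨ ∃ i, v = EuclideanSpace.single i 1) :
    ‖v‖ ≤ 1 := by
  rcases hv with rfl | ⟨i, rfl⟩ <;> simp

theorem mul_exp_assocFn_le {M : ℕ → ℝ} (hM : IsM1 M) {a B t : ℝ} (ha : 0 ≤ a) (ht : 0 ≤ t)
    (h : ∀ n, t ^ n * a ≤ B * M n) : a * Real.exp (assocFn M t) ≤ B * M 0 := by
  have hB : a ≤ B * M 0 := by simpa using h 0
  rcases eq_or_ne t 0 with rfl | ht0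
  · simpa [assocFn] using hB
  have htpos : 0 < t := lt_of_le_of_ne ht ht0.symm
  rcases ha.eq_or_lt with rfl | ha
  · simpa using hB
  rw [← le_div_iff₀' ha, ← Real.le_log_iff_exp_le (div_pos (ha.trans_le hB) ha), assocFn,
    if_neg ht0]
  refine ciSup_le fun n => ?_
  have h0 := hM.1 0
  have hn := hM.1 n
  refine Real.log_le_log (by positivity) ?_
  rw [div_le_div_iff₀ hn ha]
  nlinarith [mul_le_mul_of_nonneg_right (h n) h0.le]

theorem exists_bound_mderiv_STFTf {M : ℕ → ℝ} (hM : IsM1 M) {A H : ℝ} (hH : 1 ≤ H)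
    (hM2 : ∀ p : ℕ, M (p + 1) ≤ A * H ^ p * M p) {ψ : Rd d → ℂ} (hψ : ContDiff ℝ (⊤ : ℕ∞) ψ)
    (hψc : HasCompactSupport ψ) (hψb : ∀ h > (0 : ℝ), EnormFin M h Set.univ ψ) (R : ℝ) {k : ℕ}
    {s : ℝ} (hs : 0 < s) (hsk : k * √d * ((k + 2) * s) ≤ 2 * π) (α β : Fin d → ℕ)
    (hβ : mOrd β ≤ k) :
    ∃ C ≥ (0 : ℝ), ∀ φ : Rd d → ℂ, ContDiff ℝ (⊤ : ℕ∞) φ → HasCompactSupport φ →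
      tsupport φ ⊆ Metric.closedBall 0 R → EnormFin M s (Metric.closedBall 0 R) φ →
      ∀ x ξ : Rd d, ‖mderiv α (fun x' => mderiv β (fun ξ' => STFTf ψ φ x' ξ') ξ) x‖ *
        Real.exp (assocFn M (k * ‖ξ‖)) ≤ C * Enorm M s (Metric.closedBall 0 R) φ := by
  obtain ⟨hαs, hαb⟩ := timeWindow_spec hM hH hM2 hψ hψb α
  obtain ⟨c₀, hc₀, hcoord⟩ := dirBound_coordMul (d := d) hM R hs
  set W := Enorm M s Set.univ (timeWindow α ψ) with hW
  have hW0 : 0 ≤ W := Enorm_nonneg hM hs _ _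
  have hM0 := (hM.1 0).le
  refine ⟨(c₀ * M 0) ^ mOrd β * W * M 0 * volume.real (Metric.closedBall (0 : Rd d) R) * M 0,
    by positivity, fun φ hφ hφc hφR hφb x ξ => ?_⟩
  set E := Enorm M s (Metric.closedBall 0 R) φ with hE
  have hE0 : 0 ≤ E := Enorm_nonneg hM hs _ _
  obtain ⟨hβs, hβc, hβR⟩ := freqMul_spec hφ hφc hφR β
  have hder : mderiv α (fun x' => mderiv β (fun ξ' => STFTf ψ φ x' ξ') ξ) x =
      STFTf (timeWindow α ψ) (freqMul β φ) x ξ := by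
    have : (fun x' => mderiv β (fun ξ' => STFTf ψ φ x' ξ') ξ) =
        fun x' => STFTf ψ (freqMul β φ) x' ξ := by
      funext x'
      exact congrFun (mderiv_STFTf_freq β hψ hφ hφc x') ξ
    rw [this, mderiv_STFTf_time α hψ hψc hβs.continuous]
  obtain ⟨v, hv, hξ⟩ := exists_dir_norm_le ξ
  have hb1 : DirBound M v (Metric.closedBall 0 R) s E 0 φ :=
    DirBound.of_mderiv hM hs.le hE0 hφ
      (fun γ t ht => norm_mderiv_le_Enorm hM hs hφb γ ht) hv
  have hb2 := dirBound_freqMul hM hs.le hc₀.le hE0 (hcoord v (norm_le_one_of_dir hv)) hφ hb1 β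
  have hb3 : DirBound M v (Metric.closedBall 0 R) s W 0
      (fun t => (starRingEnd ℂ) (timeWindow α ψ (t - x))) := by
    intro n t _
    rw [dirDeriv_iterate_conj_sub, RCLike.norm_conj]
    exact DirBound.of_mderiv (K := Set.univ) hM hs.le hW0 hαs
      (fun γ t ht => norm_mderiv_le_Enorm hM hs (hαb s hs) γ ht) hv n (t - x) trivial
  have hb4 := hb2.mul hM (by positivity) hs.le (by positivity) hW0 hβs
    (contDiff_conj_sub hαs x) hb3
  have hmain := norm_fourier_mul_pow_le
    (F := freqMul β φ * fun t => (starRingEnd ℂ) (timeWindow α ψ (t - x)))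
    (hβs.mul (contDiff_conj_sub hαs x)) hβc.mul_right
    ((tsupport_mul_subset_left).trans hβR) hb4 ξ
  rw [hder, STFTf_eq_fourier]
  refine (mul_exp_assocFn_le hM (B := (c₀ * M 0) ^ mOrd β * W * M 0 *
    volume.real (Metric.closedBall (0 : Rd d) R) * E) (norm_nonneg _) (by positivity)
    fun n => ?_).trans_eq (by ring)
  set q : ℝ := s + mOrd β * s + s with hq
  have hq0 : 0 < q := by positivity
  have hqk : k * √d * q ≤ 2 * π := by
    refine le_trans ?_ hsk
    have : (mOrd β : ℝ) ≤ k := by exact_mod_cast hβ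
    have : q ≤ (k + 2) * s := by rw [hq]; nlinarith
    gcongr
  have hMn := hM.1 n
  have h1 : k * ‖ξ‖ * q ≤ 2 * π * |inner ℝ ξ v| :=
    calc k * ‖ξ‖ * q ≤ k * (√d * |inner ℝ ξ v|) * q := by gcongr
      _ = k * √d * q * |inner ℝ ξ v| := by ring
      _ ≤ _ := by gcongr
  have hqn : 0 < q ^ n := by positivity
  refine le_of_mul_le_mul_right ?_ hqn
  refine le_trans ?_ ((hmain n).trans_eq (by ring))
  rw [mul_right_comm, ← mul_pow]
  gcongr

/-- mapping properties of the STFT on `D^{(M_p)}`: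
vanishing of `V_ψφ` for `|x| > 2R` and the bound
`sup_{|α|,|β| ≤ k} |∂_x^α ∂_ξ^β V_ψφ(x,ξ)| e^{M(k|ξ|)} ≤ C ‖φ‖_{E^{M_p,ℓ}(B̄(0,R))}`. -/
theorem stmt0 {d : ℕ} (M : ℕ → ℝ) (A H : ℝ) (hM1 : IsM1 M)
    (hA : 1 ≤ A) (hH : 1 ≤ H) (hM2' : ∀ p : ℕ, M (p + 1) ≤ A * H ^ p * M p)
    (ψ : Rd d → ℂ) (R₀ : ℝ) (hψsm : ContDiff ℝ (⊤ : ℕ∞) ψ)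
    (hψsupp : tsupport ψ ⊆ Metric.closedBall 0 R₀)
    (hψb : ∀ ℓ > (0 : ℝ), EnormFin M ℓ Set.univ ψ) :
    ∀ R > R₀, ∀ k : ℕ, ∃ ℓ > (0 : ℝ), ∃ C > (0 : ℝ), ∀ φ : Rd d → ℂ,
      ContDiff ℝ (⊤ : ℕ∞) φ → HasCompactSupport φ →
      tsupport φ ⊆ Metric.closedBall 0 R →
      EnormFin M ℓ (Metric.closedBall 0 R) φ →
      (∀ x ξ : Rd d, 2 * R < ‖x‖ → STFTf ψ φ x ξ = 0) ∧
      (∀ α β : Fin d → ℕ, mOrd α ≤ k → mOrd β ≤ k → ∀ x ξ : Rd d,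
        ‖mderiv α (fun x' => mderiv β (fun ξ' => STFTf ψ φ x' ξ') ξ) x‖ *
          Real.exp (assocFn M (k * ‖ξ‖)) ≤ C * Enorm M ℓ (Metric.closedBall 0 R) φ) := by
  intro R hR k
  have hψc : HasCompactSupport ψ :=
    (isCompact_closedBall (0 : Rd d) R₀).of_isClosed_subset (isClosed_tsupport ψ) hψsupp
  set s : ℝ := 1 / ((k + 2) * (k * √d + 1)) with hs
  have hs0 : 0 < s := by positivity
  have hsk : k * √d * ((k + 2) * s) ≤ 2 * π := by
    have h1 : (k + 2) * s = 1 / (k * √d + 1) := by rw [hs]; field_simp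
    have h2 : k * √d * (1 / (k * √d + 1)) ≤ 1 := by
      rw [mul_one_div, div_le_one (by positivity)]; linarith
    rw [h1]
    linarith [Real.pi_gt_three]
  have hfin : ∀ α β : Fin d → ℕ, ∃ C ≥ (0 : ℝ), mOrd β ≤ k → ∀ φ : Rd d → ℂ,
      ContDiff ℝ (⊤ : ℕ∞) φ → HasCompactSupport φ →
      tsupport φ ⊆ Metric.closedBall 0 R → EnormFin M s (Metric.closedBall 0 R) φ →
      ∀ x ξ : Rd d, ‖mderiv α (fun x' => mderiv β (fun ξ' => STFTf ψ φ x' ξ') ξ) x‖ *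
        Real.exp (assocFn M (k * ‖ξ‖)) ≤ C * Enorm M s (Metric.closedBall 0 R) φ := by
    intro α β
    by_cases hβ : mOrd β ≤ k
    · obtain ⟨C, hC, h⟩ :=
        exists_bound_mderiv_STFTf hM1 hH hM2' hψsm hψc hψb R hs0 hsk α β hβ
      exact ⟨C, hC, fun _ => h⟩
    · exact ⟨0, le_rfl, fun h => absurd h hβ⟩
  choose C hC0 hC using hfin
  set S : Finset (Fin d → ℕ) := Fintype.piFinset fun _ => Finset.range (k + 1) with hS
  have hmem : ∀ α : Fin d → ℕ, mOrd α ≤ k → α ∈ S := by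
    intro α hα
    rw [hS, Fintype.mem_piFinset]
    intro i
    have : α i ≤ mOrd α := Finset.single_le_sum (fun _ _ => Nat.zero_le _) (Finset.mem_univ i)
    rw [Finset.mem_range]
    omega
  refine ⟨s, hs0, ∑ p ∈ S ×ˢ S, C p.1 p.2 + 1,
    add_pos_of_nonneg_of_pos (Finset.sum_nonneg fun p _ => hC0 p.1 p.2) one_pos,
    fun φ hφ hφc hφR hφb => ⟨fun x ξ hx => STFTf_eq_zero hR hψsupp hφR hx ξ,
      fun α β hα hβ x ξ => (hC α β hβ φ hφ hφc hφR hφb x ξ).trans ?_⟩⟩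
  refine mul_le_mul_of_nonneg_right ?_ (Enorm_nonneg hM1 hs0 _ _)
  have := Finset.single_le_sum (f := fun p : (Fin d → ℕ) × (Fin d → ℕ) => C p.1 p.2)
    (fun p _ => hC0 p.1 p.2) (Finset.mk_mem_product (hmem α hα) (hmem β hβ))
  simp only at this
  linarith
end
end

section
/- For every ε > 0 and every dimension d ≥ 1 there exist constants c_{0,ε}, c_{1,ε} > 0 with the following property: whenever V ⊆ ℝ^d is open, ω : V → (0,∞) is a positive function, and g : V_ε → ℂ (where V_ε := V + B(0,ε)) is measurable and locally bounded with S := sup_{x∈V, |h|≤ε} |g(x+h)|/ω(x) < ∞, there exist continuous functions g₀, g₁ : V → ℂ such that sup_{x∈V} |g_j(x)|/ω(x) ≤ c_{j,ε} S for j = 0, 1, and g = Δg₁ + g₀ in the sense of distributions on V, i.e. ∫_V g(x)φ(x)dx = ∫_V g₁(x)Δφ(x)dx + ∫_V g₀(x)φ(x)dx for every smooth compactly supported φ : ℝ^d → ℂ with supp φ ⊂ V. -/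
open MeasureTheory Real
open scoped BigOperators Pointwise

noncomputable section

variable {d : ℕ}

/-- The Laplacian `Δφ = ∑ ∂²φ/∂x_i²`. -/
def lapl {d : ℕ} (φ : Rd d → ℂ) : Rd d → ℂ := fun x => ∑ i : Fin d, pder i (pder i φ) x

section WeightedTranslates

variable {Θ : Type*} [MeasurableSpace Θ]

/-- The weighted superposition `x ↦ ∫ w(θ) g(x + h(θ)) dν(θ)` of translates of `g`. -/
def translateAvg (ν : Measure Θ) (w : Θ → ℝ) (h : Θ → Rd d) (g : Rd d → ℂ) (x : Rd d) : ℂ :=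
  ∫ θ, w θ • g (x + h θ) ∂ν

theorem norm_translateAvg_le {ν : Measure Θ} {w : Θ → ℝ} {h : Θ → Rd d} {g : Rd d → ℂ}
    {x : Rd d} {B : ℝ} (hw : Integrable w ν) (hB : ∀ θ, w θ ≠ 0 → ‖g (x + h θ)‖ ≤ B) :
    ‖translateAvg ν w h g x‖ ≤ (∫ θ, |w θ| ∂ν) * B := by
  rw [← integral_mul_const]
  refine norm_integral_le_of_norm_le (hw.abs.mul_const B) (ae_of_all _ fun θ => ?_)
  rw [norm_smul, Real.norm_eq_abs]
  by_cases hθ : w θ = 0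
  · simp [hθ]
  · exact mul_le_mul_of_nonneg_left (hB θ hθ) (abs_nonneg _)

theorem translateAvg_congr {ν : Measure Θ} {w : Θ → ℝ} {h : Θ → Rd d} {g g' : Rd d → ℂ}
    {x : Rd d} (hg : ∀ θ, w θ ≠ 0 → g (x + h θ) = g' (x + h θ)) :
    translateAvg ν w h g x = translateAvg ν w h g' x := by
  refine integral_congr_ae (ae_of_all _ fun θ => ?_)
  by_cases hθ : w θ = 0
  · simp [hθ]
  · simp only [hg θ hθ]

theorem continuousAt_translateAvg {ν : Measure Θ} {w : Θ → ℝ} {h : Θ → Rd d} {a : ℝ} (ha : 0 < a)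
    (hh : ∀ θ, w θ ≠ 0 → ‖h θ‖ ≤ a)
    (hcont : ∀ f : Rd d → ℂ, Measurable f → (∃ B, ∀ x, ‖f x‖ ≤ B) →
      Continuous (translateAvg ν w h f))
    {g : Rd d → ℂ} (hg : Measurable g) {x₀ : Rd d} {B : ℝ}
    (hB : ∀ y ∈ Metric.closedBall x₀ (a + a), ‖g y‖ ≤ B) :
    ContinuousAt (translateAvg ν w h g) x₀ := by
  have hc := hcont ((Metric.closedBall x₀ (a + a)).indicator g)
    (hg.indicator measurableSet_closedBall) ⟨max B 0, fun x => by
      by_cases hx : x ∈ Metric.closedBall x₀ (a + a)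
      · rw [Set.indicator_of_mem hx]; exact (hB x hx).trans (le_max_left _ _)
      · rw [Set.indicator_of_notMem hx]; simp⟩
  refine hc.continuousAt.congr ?_
  filter_upwards [Metric.ball_mem_nhds x₀ ha] with x hx
  refine translateAvg_congr fun θ hθ => Set.indicator_of_mem ?_ g
  rw [Metric.mem_closedBall, dist_eq_norm]
  rw [Metric.mem_ball, dist_eq_norm] at hx
  calc ‖x + h θ - x₀‖ = ‖(x - x₀) + h θ‖ := by congr 1; abel
    _ ≤ ‖x - x₀‖ + ‖h θ‖ := norm_add_le _ _
    _ ≤ a + a := add_le_add hx.le (hh θ hθ)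

theorem integrable_smul_translate {ν : Measure Θ} [SFinite ν] {w : Θ → ℝ} {h : Θ → Rd d}
    (hwm : Measurable w) (hw : Integrable w ν) (hh : Measurable h)
    {ψ : Rd d → ℂ} (hψc : Continuous ψ) (hψ : Integrable ψ) :
    Integrable (fun p : Rd d × Θ => w p.2 • ψ (p.1 - h p.2)) (volume.prod ν) := by
  have hm : Measurable fun p : Rd d × Θ => w p.2 • ψ (p.1 - h p.2) :=
    (hwm.comp measurable_snd).smul
      (hψc.measurable.comp (measurable_fst.sub (hh.comp measurable_snd)))
  rw [integrable_prod_iff' hm.aestronglyMeasurable]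
  refine ⟨ae_of_all _ fun θ => (hψ.comp_sub_right (h θ)).smul (w θ), ?_⟩
  have : ∀ θ, (∫ y, ‖w θ • ψ (y - h θ)‖) = |w θ| * ∫ y, ‖ψ y‖ := fun θ => by
    simp_rw [norm_smul, Real.norm_eq_abs]
    rw [integral_const_mul, integral_sub_right_eq_self (fun y => ‖ψ y‖) (h θ)]
  simp_rw [this]
  exact hw.abs.mul_const _

theorem integrable_mul_translateAvg_neg {ν : Measure Θ} [SFinite ν] {w : Θ → ℝ} {h : Θ → Rd d}
    (hwm : Measurable w) (hw : Integrable w ν) (hh : Measurable h)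
    {g : Rd d → ℂ} (hg : Measurable g) {B : ℝ} (hB : ∀ x, ‖g x‖ ≤ B)
    {ψ : Rd d → ℂ} (hψc : Continuous ψ) (hψ : Integrable ψ) :
    Integrable fun y => g y * translateAvg ν w (fun θ => -h θ) ψ y := by
  have h1 := (integrable_smul_translate hwm hw hh hψc hψ).integral_prod_left
  simp only [translateAvg, ← sub_eq_add_neg]
  exact h1.bdd_mul hg.aestronglyMeasurable (ae_of_all _ hB)

theorem integral_translateAvg_mul {ν : Measure Θ} [SFinite ν] {w : Θ → ℝ} {h : Θ → Rd d}
    (hwm : Measurable w) (hw : Integrable w ν) (hh : Measurable h)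
    {g : Rd d → ℂ} (hg : Measurable g) {B : ℝ} (hB : ∀ x, ‖g x‖ ≤ B)
    {ψ : Rd d → ℂ} (hψc : Continuous ψ) (hψ : Integrable ψ) :
    ∫ x, translateAvg ν w h g x * ψ x =
      ∫ y, g y * translateAvg ν w (fun θ => -h θ) ψ y := by
  have hi1 : Integrable (fun p : Rd d × Θ => w p.2 • g (p.1 + h p.2) * ψ p.1)
      (volume.prod ν) := by
    have h1 : Integrable (fun p : Rd d × Θ => g (p.1 + h p.2) * (ψ p.1 * (w p.2 : ℂ)))
        (volume.prod ν) :=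
      (hψ.mul_prod hw.ofReal).bdd_mul
        (hg.comp (measurable_fst.add (hh.comp measurable_snd))).aestronglyMeasurable
        (ae_of_all _ fun p => hB _)
    refine h1.congr (ae_of_all _ fun p => ?_)
    simp only [Complex.real_smul]
    ring
  have hi2 : Integrable (fun p : Rd d × Θ => g p.1 * (w p.2 • ψ (p.1 - h p.2)))
      (volume.prod ν) :=
    (integrable_smul_translate hwm hw hh hψc hψ).bdd_mul
      (hg.comp measurable_fst).aestronglyMeasurable (ae_of_all _ fun p => hB _)
  simp only [translateAvg, ← sub_eq_add_neg, ← integral_mul_const, ← integral_const_mul]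
  refine (integral_integral_swap hi1).trans (Eq.trans ?_ (integral_integral_swap hi2).symm)
  refine integral_congr_ae (ae_of_all _ fun θ => ?_)
  dsimp only
  rw [← integral_sub_right_eq_self _ (h θ)]
  refine integral_congr_ae (ae_of_all _ fun y => ?_)
  simp only [Complex.real_smul, sub_add_cancel]
  ring

end WeightedTranslates

theorem continuous_integral_smul_dilate {k : Rd d → ℝ} (hk : Continuous k)
    (hks : HasCompactSupport k) {t : ℝ} (ht : t ≠ 0) {g : Rd d → ℂ} (hg : Measurable g) {B : ℝ}
    (hB : ∀ x, ‖g x‖ ≤ B) : Continuous fun x => ∫ z, k z • g (x + t • z) := by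
  have hgl : LocallyIntegrable g (volume : Measure (Rd d)) :=
    (locallyIntegrable_const B).mono hg.aestronglyMeasurable
      (ae_of_all _ fun x => (hB x).trans (le_abs_self B))
  have hcs : HasCompactSupport fun z : Rd d => k ((-t)⁻¹ • z) :=
    hks.comp_homeomorph (Homeomorph.smulOfNeZero (-t)⁻¹ (inv_ne_zero (neg_ne_zero.2 ht)))
  have hcc : Continuous fun z : Rd d => k ((-t)⁻¹ • z) := hk.comp (continuous_const_smul _)
  have hconv := hcs.continuous_convolution_right
    ((ContinuousLinearMap.lsmul ℝ ℝ (E := ℂ)).flip) hgl hcc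
  refine (hconv.const_smul (|(t ^ Module.finrank ℝ (Rd d))⁻¹|)).congr fun x => ?_
  rw [Pi.smul_apply, convolution_def]
  simp only [ContinuousLinearMap.flip_apply, ContinuousLinearMap.lsmul_apply]
  have h1 := Measure.integral_comp_smul (volume : Measure (Rd d))
    (fun y => k (t⁻¹ • y) • g (x + y)) t
  simp only [smul_smul, inv_mul_cancel₀ ht, one_smul] at h1
  rw [h1, ← integral_add_left_eq_self _ x]
  congr 2
  ext y
  simp [sub_eq_add_neg]

/-- The truncated paraboloid `(1 - |z|²)₊`. -/
def parab (z : Rd d) : ℝ := max 0 (1 - ‖z‖ ^ 2)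

theorem parab_nonneg (z : Rd d) : 0 ≤ parab z := le_max_left _ _

theorem continuous_parab : Continuous (parab : Rd d → ℝ) := by
  unfold parab; fun_prop

theorem norm_le_one_of_parab_ne_zero {z : Rd d} (hz : parab z ≠ 0) : ‖z‖ ≤ 1 := by
  by_contra! h
  exact hz (max_eq_left (by nlinarith))

theorem hasCompactSupport_parab : HasCompactSupport (parab : Rd d → ℝ) :=
  HasCompactSupport.of_support_subset_isCompact (isCompact_closedBall 0 1) fun z hz => by
    simpa using norm_le_one_of_parab_ne_zero hz

theorem integral_parab_pos : 0 < ∫ z : Rd d, parab z := by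
  refine continuous_parab.integral_pos_of_hasCompactSupport_nonneg_nonzero
    hasCompactSupport_parab parab_nonneg (x := 0) ?_
  simp [parab]

theorem hasDerivAt_posPart_sq (s : ℝ) : HasDerivAt (fun s : ℝ => max 0 s ^ 2) (2 * max 0 s) s := by
  rcases lt_trichotomy s 0 with hs | rfl | hs
  · rw [max_eq_left hs.le, mul_zero]
    refine (hasDerivAt_const s (0 : ℝ)).congr_of_eventuallyEq ?_
    filter_upwards [Iio_mem_nhds hs] with x hx
    rw [max_eq_left (le_of_lt hx)]; norm_num
  · rw [max_self, mul_zero, hasDerivAt_iff_isLittleO]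
    have : (fun x : ℝ => max 0 x ^ 2) =O[nhds 0] fun x => x ^ 2 :=
      Asymptotics.IsBigO.of_norm_le fun x => by
        rw [Real.norm_of_nonneg (sq_nonneg _)]
        rcases le_total x 0 with h | h
        · rw [max_eq_left h]; nlinarith [sq_nonneg x]
        · rw [max_eq_right h]
    simpa using this.trans_isLittleO (Asymptotics.isLittleO_pow_id one_lt_two)
  · rw [max_eq_right hs.le]
    have := (hasDerivAt_pow 2 s)
    simp only [Nat.cast_ofNat, Nat.add_one_sub_one, pow_one] at this
    refine this.congr_of_eventuallyEq ?_
    filter_upwards [Ioi_mem_nhds hs] with x hx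
    rw [max_eq_right (le_of_lt hx)]

theorem hasFDerivAt_parab_sq (z : Rd d) :
    HasFDerivAt (fun z : Rd d => parab z ^ 2) ((2 * parab z) • -((2 : ℕ) • innerSL ℝ z)) z :=
  HasDerivAt.comp_hasFDerivAt (h₂ := fun s : ℝ => max 0 s ^ 2)
    (f := fun z : Rd d => 1 - ‖z‖ ^ 2) z (hasDerivAt_posPart_sq (1 - ‖z‖ ^ 2))
    ((hasStrictFDerivAt_norm_sq z).hasFDerivAt.const_sub 1)

theorem fderiv_apply_eq_sum_pder (φ : Rd d → ℂ) (x z : Rd d) :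
    fderiv ℝ φ x z = ∑ i, z i • pder i φ x := by
  conv_lhs => rw [← (EuclideanSpace.basisFun (Fin d) ℝ).sum_repr z]
  simp [pder, map_sum]

theorem contDiff_pder {φ : Rd d → ℂ} (hφ : ContDiff ℝ (⊤ : ℕ∞) φ) (i : Fin d) :
    ContDiff ℝ (⊤ : ℕ∞) (pder i φ) :=
  (hφ.fderiv_right (m := (⊤ : ℕ∞)) (by simp)).clm_apply contDiff_const

theorem tsupport_pder_subset (φ : Rd d → ℂ) (i : Fin d) : tsupport (pder i φ) ⊆ tsupport φ :=
  tsupport_fderiv_apply_subset ℝ (EuclideanSpace.single i 1)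

theorem lapl_eq_zero_of_notMem_tsupport {φ : Rd d → ℂ} {x : Rd d} (hx : x ∉ tsupport φ) :
    lapl φ x = 0 :=
  Finset.sum_eq_zero fun _ _ => image_eq_zero_of_notMem_tsupport fun h =>
    hx (tsupport_pder_subset _ _ (tsupport_pder_subset _ _ h))

theorem continuous_lapl {φ : Rd d → ℂ} (hφ : ContDiff ℝ (⊤ : ℕ∞) φ) : Continuous (lapl φ) :=
  continuous_finsetSum _ fun i _ => (contDiff_pder (contDiff_pder hφ i) i).continuous

theorem hasCompactSupport_lapl {φ : Rd d → ℂ} (hφ : HasCompactSupport φ) :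
    HasCompactSupport (lapl φ) :=
  HasCompactSupport.intro hφ fun _ hx => lapl_eq_zero_of_notMem_tsupport hx

theorem integrable_smul_dilate {k : Rd d → ℝ} (hk : Continuous k) (hks : HasCompactSupport k)
    {ψ : Rd d → ℂ} (hψ : Continuous ψ) (y : Rd d) (t : ℝ) :
    Integrable fun z => k z • ψ (y - t • z) :=
  (hk.smul (hψ.comp (by fun_prop))).integrable_of_hasCompactSupport hks.smul_right

theorem hasFDerivAt_comp_sub_smul {ψ : Rd d → ℂ} (hψ : ContDiff ℝ (⊤ : ℕ∞) ψ) (y : Rd d) (t : ℝ)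
    (z : Rd d) :
    HasFDerivAt (fun z => ψ (y - t • z))
      ((fderiv ℝ ψ (y - t • z)).comp (-(t • ContinuousLinearMap.id ℝ (Rd d)))) z :=
  ((hψ.differentiable (by simp)).differentiableAt.hasFDerivAt (x := y - t • z)).comp z
    (((hasFDerivAt_id z).const_smul t).const_sub y)

theorem hasCompactSupport_parab_sq : HasCompactSupport fun z : Rd d => parab z ^ 2 :=
  hasCompactSupport_parab.comp_left (g := fun s : ℝ => s ^ 2) (by simp)

theorem integral_parab_sq_smul_pder {ψ : Rd d → ℂ} (hψ : ContDiff ℝ (⊤ : ℕ∞) ψ) (y : Rd d)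
    (t : ℝ) (i : Fin d) :
    ∫ z : Rd d, (parab z * -z i) • ψ (y - t • z) =
      (t / 4) • ∫ z : Rd d, parab z ^ 2 • pder i ψ (y - t • z) := by
  have hf (z : Rd d) : (((2 * parab z) • -((2 : ℕ) • innerSL ℝ z)) : Rd d →L[ℝ] ℝ)
      (EuclideanSpace.single i 1) = 4 * (parab z * -z i) := by
    simp [EuclideanSpace.inner_single_right]
    ring
  have hg (z : Rd d) : ((fderiv ℝ ψ (y - t • z)).comp (-(t • ContinuousLinearMap.id ℝ (Rd d))))
      (EuclideanSpace.single i 1) = -(t • pder i ψ (y - t • z)) := by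
    simp [pder]
  have hi := contDiff_pder hψ i
  have hk : Continuous fun z : Rd d => parab z * -z i :=
    continuous_parab.mul (by fun_prop)
  have hibp := integral_bilinear_hasFDerivAt_right_eq_neg_left_of_integrable
    (μ := (volume : Measure (Rd d))) (B := ContinuousLinearMap.lsmul ℝ ℝ (E := ℂ))
    (f := fun z : Rd d => parab z ^ 2) (g := fun z => ψ (y - t • z))
    (v := EuclideanSpace.single i (1 : ℝ))
    (f' := fun z => (2 * parab z) • -((2 : ℕ) • innerSL ℝ z))
    (g' := fun z => (fderiv ℝ ψ (y - t • z)).comp (-(t • ContinuousLinearMap.id ℝ (Rd d))))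
    ?_ ?_ ?_ (fun z _ => hasFDerivAt_parab_sq z) (fun z _ => hasFDerivAt_comp_sub_smul hψ y t z)
  · simp only [hf, hg, ContinuousLinearMap.lsmul_apply] at hibp
    simp only [smul_neg, integral_neg, smul_comm _ t, integral_smul, neg_inj, mul_smul (4 : ℝ)] at hibp
    rw [div_eq_inv_mul, mul_smul, hibp, inv_smul_smul₀ (four_ne_zero' ℝ)]
  · simp only [hf, ContinuousLinearMap.lsmul_apply, mul_smul (4 : ℝ)]
    exact (integrable_smul_dilate hk hasCompactSupport_parab.mul_right hψ.continuous y t).smul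
      (4 : ℝ)
  · simp only [hg, ContinuousLinearMap.lsmul_apply]
    simp only [smul_neg, smul_comm _ t]
    exact ((integrable_smul_dilate (continuous_parab.pow 2) hasCompactSupport_parab_sq
      hi.continuous y t).smul t).neg
  · exact integrable_smul_dilate (continuous_parab.pow 2) hasCompactSupport_parab_sq
      hψ.continuous y t

/-- Integration by parts against `(1 - |z|²)₊²`, whose gradient is `-4 (1 - |z|²)₊ z`. -/
theorem integral_parab_smul_fderiv {φ : Rd d → ℂ} (hφ : ContDiff ℝ (⊤ : ℕ∞) φ) (y : Rd d)
    (t : ℝ) :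
    ∫ z : Rd d, parab z • fderiv ℝ φ (y - t • z) (-z) =
      (t / 4) • ∫ z : Rd d, parab z ^ 2 • lapl φ (y - t • z) := by
  have hint (i : Fin d) :
      Integrable fun z : Rd d => parab z ^ 2 • pder i (pder i φ) (y - t • z) :=
    integrable_smul_dilate (continuous_parab.pow 2) hasCompactSupport_parab_sq
      (contDiff_pder (contDiff_pder hφ i) i).continuous y t
  simp only [fderiv_apply_eq_sum_pder, lapl, Finset.smul_sum]
  rw [integral_finsetSum _ fun i _ => ?_, integral_finsetSum _ fun i _ => hint i,
    Finset.smul_sum]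
  · refine Finset.sum_congr rfl fun i _ => ?_
    rw [← integral_parab_sq_smul_pder (contDiff_pder hφ i) y t i]
    simp only [smul_smul, PiLp.neg_apply]
  · simp only [smul_smul]
    exact integrable_smul_dilate (continuous_parab.mul (by fun_prop))
      hasCompactSupport_parab.mul_right (contDiff_pder hφ i).continuous y t

theorem hasDerivAt_integral_parab_smul {φ : Rd d → ℂ} (hφ : ContDiff ℝ (⊤ : ℕ∞) φ)
    (hφs : HasCompactSupport φ) (y : Rd d) (t : ℝ) :
    HasDerivAt (fun t : ℝ => ∫ z : Rd d, parab z • φ (y - t • z))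
      (∫ z : Rd d, parab z • fderiv ℝ φ (y - t • z) (-z)) t := by
  have hφ' : Continuous (fderiv ℝ φ) := hφ.continuous_fderiv (by simp)
  obtain ⟨C, hC⟩ := (hφs.fderiv ℝ).exists_bound_of_continuous hφ'
  refine (hasDerivAt_integral_of_dominated_loc_of_deriv_le
    (F := fun (t : ℝ) (z : Rd d) => parab z • φ (y - t • z))
    (F' := fun (t : ℝ) (z : Rd d) => parab z • fderiv ℝ φ (y - t • z) (-z))
    (bound := fun z => parab z * C) Filter.univ_mem
    (Filter.Eventually.of_forall fun s =>
      (integrable_smul_dilate continuous_parab hasCompactSupport_parab hφ.continuous y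
        s).aestronglyMeasurable)
    (integrable_smul_dilate continuous_parab hasCompactSupport_parab hφ.continuous y t)
    (Continuous.aestronglyMeasurable (continuous_parab.smul
      ((hφ'.comp (by fun_prop)).clm_apply continuous_neg)))
    (ae_of_all _ fun z s _ => ?_)
    ((continuous_parab.integrable_of_hasCompactSupport hasCompactSupport_parab).mul_const C)
    (ae_of_all _ fun z s _ => ?_)).2
  · rw [norm_smul, Real.norm_of_nonneg (parab_nonneg z)]
    by_cases hz : parab z = 0
    · simp [hz]
    · refine mul_le_mul_of_nonneg_left ?_ (parab_nonneg z)
      calc _ ≤ ‖fderiv ℝ φ (y - s • z)‖ * ‖-z‖ := ContinuousLinearMap.le_opNorm _ _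
        _ ≤ ‖fderiv ℝ φ (y - s • z)‖ * 1 := by
          rw [norm_neg]
          exact mul_le_mul_of_nonneg_left (norm_le_one_of_parab_ne_zero hz) (norm_nonneg _)
        _ ≤ C := by rw [mul_one]; exact hC _
  · have h1 : HasDerivAt (fun s : ℝ => y - s • z) (-z) s := by
      simpa using ((hasDerivAt_id s).smul_const z).const_sub y
    exact (((hφ.differentiable (by simp)).differentiableAt.hasFDerivAt
      (x := y - s • z)).comp_hasDerivAt s h1).const_smul (parab z)

theorem parab_representation {φ : Rd d → ℂ} (hφ : ContDiff ℝ (⊤ : ℕ∞) φ)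
    (hφs : HasCompactSupport φ) (y : Rd d) (a : ℝ) :
    (∫ z : Rd d, parab z) • φ y = (∫ z : Rd d, parab z • φ (y - a • z)) -
      ∫ t in (0 : ℝ)..a, (t / 4) • ∫ z : Rd d, parab z ^ 2 • lapl φ (y - t • z) := by
  have hl := continuous_lapl hφ
  obtain ⟨C, hC⟩ := (hasCompactSupport_lapl hφs).exists_bound_of_continuous hl
  have hcont : Continuous fun t : ℝ => ∫ z : Rd d, parab z ^ 2 • lapl φ (y - t • z) := by
    refine continuous_of_dominated (bound := fun z => parab z ^ 2 * C)
      (fun t => (integrable_smul_dilate (continuous_parab.pow 2) hasCompactSupport_parab_sq hl y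
        t).aestronglyMeasurable) (fun t => ae_of_all _ fun z => ?_)
      (((continuous_parab.pow 2).integrable_of_hasCompactSupport
        hasCompactSupport_parab_sq).mul_const C)
      (ae_of_all _ fun z => by fun_prop)
    rw [norm_smul, Real.norm_of_nonneg (sq_nonneg _)]
    exact mul_le_mul_of_nonneg_left (hC _) (sq_nonneg _)
  have hftc := intervalIntegral.integral_eq_sub_of_hasDerivAt (a := 0) (b := a)
    (f' := fun t => (t / 4) • ∫ z : Rd d, parab z ^ 2 • lapl φ (y - t • z))
    (fun t _ => integral_parab_smul_fderiv hφ y t ▸ hasDerivAt_integral_parab_smul hφ hφs y t)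
    (((continuous_id.div_const 4).smul hcont).intervalIntegrable _ _)
  simp only [zero_smul, sub_zero, integral_smul_const] at hftc
  rw [hftc, sub_sub_cancel]

/-- The normalized paraboloid weight, of total mass one. -/
def ballWeight (z : Rd d) : ℝ := parab z / ∫ z : Rd d, parab z

/-- The weight of the parametrix of the Laplacian, in dilation coordinates `(t, z) ↦ t z`. -/
def parametrixWeight (a : ℝ) (p : ℝ × Rd d) : ℝ :=
  (Set.Ioc 0 a).indicator id p.1 * (parab p.2 ^ 2 / (-4 * ∫ z : Rd d, parab z))

theorem continuous_ballWeight : Continuous (ballWeight : Rd d → ℝ) :=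
  continuous_parab.div_const _

theorem hasCompactSupport_ballWeight : HasCompactSupport (ballWeight : Rd d → ℝ) :=
  hasCompactSupport_parab.comp_left (g := fun s : ℝ => s / ∫ z : Rd d, parab z) (by simp)

theorem integrable_ballWeight : Integrable (ballWeight : Rd d → ℝ) :=
  continuous_ballWeight.integrable_of_hasCompactSupport hasCompactSupport_ballWeight

theorem integral_abs_ballWeight : ∫ z : Rd d, |ballWeight z| = 1 := by
  have h (z : Rd d) : |ballWeight z| = parab z / ∫ z : Rd d, parab z :=
    abs_of_nonneg (div_nonneg (parab_nonneg z) integral_parab_pos.le)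
  simp only [h, integral_div]
  exact div_self integral_parab_pos.ne'

theorem norm_smul_le_of_ballWeight_ne_zero {a : ℝ} (ha : 0 < a) {z : Rd d}
    (hz : ballWeight z ≠ 0) : ‖a • z‖ ≤ a := by
  have := norm_le_one_of_parab_ne_zero (div_ne_zero_iff.1 hz).1
  rw [norm_smul, Real.norm_of_nonneg ha.le]
  exact mul_le_of_le_one_right ha.le this

theorem continuous_parab_sq_div :
    Continuous fun z : Rd d => parab z ^ 2 / (-4 * ∫ z : Rd d, parab z) :=
  (continuous_parab.pow 2).div_const _

theorem hasCompactSupport_parab_sq_div :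
    HasCompactSupport fun z : Rd d => parab z ^ 2 / (-4 * ∫ z : Rd d, parab z) :=
  hasCompactSupport_parab.comp_left (g := fun s : ℝ => s ^ 2 / (-4 * ∫ z : Rd d, parab z))
    (by simp)

theorem integrable_indicator_Ioc_id (a : ℝ) : Integrable ((Set.Ioc 0 a).indicator (id : ℝ → ℝ)) :=
  (continuous_id.integrableOn_Icc.mono_set Set.Ioc_subset_Icc_self).integrable_indicator
    measurableSet_Ioc

theorem measurable_parametrixWeight (a : ℝ) :
    Measurable (parametrixWeight a : ℝ × Rd d → ℝ) :=
  ((measurable_id.indicator measurableSet_Ioc).comp measurable_fst).mul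
    (continuous_parab_sq_div.measurable.comp measurable_snd)

theorem integrable_parametrixWeight (a : ℝ) :
    Integrable (parametrixWeight a : ℝ × Rd d → ℝ) (volume.prod volume) :=
  (integrable_indicator_Ioc_id a).mul_prod
    (continuous_parab_sq_div.integrable_of_hasCompactSupport hasCompactSupport_parab_sq_div)

theorem norm_smul_le_of_parametrixWeight_ne_zero {a : ℝ} {p : ℝ × Rd d}
    (hp : parametrixWeight a p ≠ 0) : ‖p.1 • p.2‖ ≤ a := by
  have ht : p.1 ∈ Set.Ioc 0 a := Set.mem_of_indicator_ne_zero (left_ne_zero_of_mul hp)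
  have hz := norm_le_one_of_parab_ne_zero
    (pow_ne_zero_iff two_ne_zero |>.1 (div_ne_zero_iff.1 (right_ne_zero_of_mul hp)).1)
  rw [norm_smul, Real.norm_of_nonneg ht.1.le]
  exact (mul_le_of_le_one_right ht.1.le hz).trans ht.2

theorem integrable_parametrixWeight_smul (a : ℝ) {f : Rd d → ℂ} (hf : Measurable f) {B : ℝ}
    (hB : ∀ x, ‖f x‖ ≤ B) {τ : ℝ × Rd d → Rd d} (hτ : Measurable τ) :
    Integrable (fun p => parametrixWeight a p • f (τ p)) (volume.prod volume) := by
  refine ((integrable_parametrixWeight a).abs.mul_const B).mono'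
    ((measurable_parametrixWeight a).smul (hf.comp hτ)).aestronglyMeasurable
    (ae_of_all _ fun p => ?_)
  rw [norm_smul, Real.norm_eq_abs]
  exact mul_le_mul_of_nonneg_left (hB _) (abs_nonneg _)

theorem translateAvg_parametrixWeight (a : ℝ) {f : Rd d → ℂ} (hf : Measurable f) {B : ℝ}
    (hB : ∀ x, ‖f x‖ ≤ B) {τ : ℝ × Rd d → Rd d} (hτ : Measurable τ) (x : Rd d) :
    translateAvg (volume.prod volume) (parametrixWeight a) τ f x =
      ∫ t : ℝ, (Set.Ioc 0 a).indicator id t •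
        ∫ z : Rd d, (parab z ^ 2 / (-4 * ∫ z : Rd d, parab z)) • f (x + τ (t, z)) := by
  rw [translateAvg, integral_prod _
    (integrable_parametrixWeight_smul a hf hB (hτ.const_add x))]
  simp only [parametrixWeight, mul_smul, integral_smul]

theorem continuous_translateAvg_ballWeight {a : ℝ} (ha : a ≠ 0) {f : Rd d → ℂ}
    (hf : Measurable f) {B : ℝ} (hB : ∀ x, ‖f x‖ ≤ B) :
    Continuous (translateAvg volume ballWeight (fun z : Rd d => a • z) f) :=
  continuous_integral_smul_dilate continuous_ballWeight hasCompactSupport_ballWeight ha hf hB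

theorem continuous_translateAvg_parametrixWeight (a : ℝ) {f : Rd d → ℂ}
    (hf : Measurable f) {B : ℝ} (hB : ∀ x, ‖f x‖ ≤ B) :
    Continuous (translateAvg (volume.prod volume) (parametrixWeight a)
      (fun p : ℝ × Rd d => p.1 • p.2) f) := by
  have hτ : Measurable fun p : ℝ × Rd d => p.1 • p.2 := measurable_fst.smul measurable_snd
  set q : Rd d → ℝ := fun z => parab z ^ 2 / (-4 * ∫ z : Rd d, parab z)
  have hqi : Integrable q :=
    continuous_parab_sq_div.integrable_of_hasCompactSupport hasCompactSupport_parab_sq_div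
  have heq := fun x => translateAvg_parametrixWeight a hf hB hτ x
  refine Continuous.congr ?_ fun x => (heq x).symm
  refine continuous_of_dominated
    (bound := fun t => |(Set.Ioc 0 a).indicator id t| * ∫ z : Rd d, |q z| * B)
    (fun x => ?_) (fun x => ae_of_all _ fun t => ?_)
    ((integrable_indicator_Ioc_id a).abs.mul_const _) (ae_of_all _ fun t => ?_)
  · have := (integrable_parametrixWeight_smul a hf hB (hτ.const_add x)).integral_prod_left
    simp only [parametrixWeight, mul_smul, integral_smul] at this
    exact this.aestronglyMeasurable
  · rw [norm_smul, Real.norm_eq_abs]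
    refine mul_le_mul_of_nonneg_left ?_ (abs_nonneg _)
    refine norm_integral_le_of_norm_le (hqi.abs.mul_const B) (ae_of_all _ fun z => ?_)
    rw [norm_smul, Real.norm_eq_abs]
    exact mul_le_mul_of_nonneg_left (hB _) (abs_nonneg _)
  · by_cases ht : t ∈ Set.Ioc 0 a
    · exact (continuous_integral_smul_dilate continuous_parab_sq_div
        hasCompactSupport_parab_sq_div ht.1.ne' hf hB).const_smul
          ((Set.Ioc 0 a).indicator (id : ℝ → ℝ) t)
    · simp only [Set.indicator_of_notMem ht, zero_smul]
      exact continuous_const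

/-- The parametrix identity `φ = T₀ φ + T₁ (Δ φ)`. -/
theorem eq_translateAvg_add_translateAvg_lapl {φ : Rd d → ℂ} (hφ : ContDiff ℝ (⊤ : ℕ∞) φ)
    (hφs : HasCompactSupport φ) {a : ℝ} (ha : 0 < a) (y : Rd d) :
    φ y = translateAvg volume ballWeight (fun z : Rd d => -(a • z)) φ y +
      translateAvg (volume.prod volume) (parametrixWeight a)
        (fun p : ℝ × Rd d => -(p.1 • p.2)) (lapl φ) y := by
  have hl := continuous_lapl hφ
  obtain ⟨C, hC⟩ := (hasCompactSupport_lapl hφs).exists_bound_of_continuous hl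
  have hI := (integral_parab_pos (d := d)).ne'
  have hrep := parab_representation hφ hφs y a
  have hτ : Measurable fun p : ℝ × Rd d => -(p.1 • p.2) :=
    (measurable_fst.smul measurable_snd).neg
  have h0 : translateAvg volume ballWeight (fun z : Rd d => -(a • z)) φ y =
      (∫ z : Rd d, parab z)⁻¹ • ∫ z : Rd d, parab z • φ (y - a • z) := by
    simp only [translateAvg, ballWeight, div_eq_inv_mul, mul_smul, integral_smul, sub_eq_add_neg]
  have h1 : translateAvg (volume.prod volume) (parametrixWeight a)
      (fun p : ℝ × Rd d => -(p.1 • p.2)) (lapl φ) y = -((∫ z : Rd d, parab z)⁻¹ •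
        ∫ t in (0 : ℝ)..a, (t / 4) • ∫ z : Rd d, parab z ^ 2 • lapl φ (y - t • z)) := by
    rw [translateAvg_parametrixWeight a hl.measurable hC hτ,
      intervalIntegral.integral_of_le ha.le, ← integral_indicator measurableSet_Ioc,
      ← integral_smul, ← integral_neg]
    refine integral_congr_ae (ae_of_all _ fun t => ?_)
    by_cases ht : t ∈ Set.Ioc 0 a
    · simp only [Set.indicator_of_mem ht, div_eq_inv_mul (parab _ ^ 2), mul_smul, integral_smul,
        ← sub_eq_add_neg, id]
      simp only [smul_smul, ← neg_smul]
      congr 1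
      field_simp
    · simp [Set.indicator_of_notMem ht]
  rw [h0, h1, ← sub_eq_add_neg, ← smul_sub, ← hrep, inv_smul_smul₀ hI]

theorem integral_mul_eq_of_bounded {a : ℝ} (ha : 0 < a) {f : Rd d → ℂ} (hf : Measurable f)
    {B : ℝ} (hB : ∀ x, ‖f x‖ ≤ B) {φ : Rd d → ℂ} (hφ : ContDiff ℝ (⊤ : ℕ∞) φ)
    (hφs : HasCompactSupport φ) :
    ∫ x, f x * φ x =
      (∫ x, translateAvg (volume.prod volume) (parametrixWeight a)
        (fun p : ℝ × Rd d => p.1 • p.2) f x * lapl φ x) +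
      ∫ x, translateAvg volume ballWeight (fun z : Rd d => a • z) f x * φ x := by
  have hτ : Measurable fun p : ℝ × Rd d => p.1 • p.2 := measurable_fst.smul measurable_snd
  have hl := continuous_lapl hφ
  have hli := hl.integrable_of_hasCompactSupport (μ := volume) (hasCompactSupport_lapl hφs)
  have hφi := hφ.continuous.integrable_of_hasCompactSupport (μ := volume) hφs
  rw [integral_translateAvg_mul (measurable_parametrixWeight a) (integrable_parametrixWeight a)
      hτ hf hB hl hli,
    integral_translateAvg_mul continuous_ballWeight.measurable integrable_ballWeight
      (measurable_const_smul a) hf hB hφ.continuous hφi,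
    ← integral_add
      (integrable_mul_translateAvg_neg (measurable_parametrixWeight a)
        (integrable_parametrixWeight a) hτ hf hB hl hli)
      (integrable_mul_translateAvg_neg continuous_ballWeight.measurable integrable_ballWeight
        (measurable_const_smul a) hf hB hφ.continuous hφi)]
  refine integral_congr_ae (ae_of_all _ fun y => ?_)
  dsimp only
  rw [← mul_add, add_comm, ← eq_translateAvg_add_translateAvg_lapl hφ hφs ha y]

theorem setIntegral_eq_integral_of_tsupport_subset {V : Set (Rd d)} {φ ψ : Rd d → ℂ}
    (hφV : tsupport φ ⊆ V) (hψ : ∀ x ∉ tsupport φ, ψ x = 0) (u v : Rd d → ℂ)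
    (huv : ∀ x ∈ tsupport φ, u x = v x) :
    ∫ x in V, u x * ψ x = ∫ x, v x * ψ x := by
  rw [setIntegral_eq_integral_of_forall_compl_eq_zero fun x hx => by
    rw [hψ x fun h => hx (hφV h), mul_zero]]
  refine integral_congr_ae (ae_of_all _ fun x => ?_)
  by_cases hx : x ∈ tsupport φ
  · simp only [huv x hx]
  · simp only [hψ x hx, mul_zero]

/-- decomposition `g = Δg₁ + g₀` with continuous functions `g₀, g₁`
dominated by `ω`, with absolute constants `c_{0,ε}, c_{1,ε}`. -/
theorem stmt6 :
    ∀ ε > (0 : ℝ), ∀ d : ℕ, 1 ≤ d → ∃ c₀ > (0 : ℝ), ∃ c₁ > (0 : ℝ),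
      ∀ (V : Set (Rd d)) (ω : Rd d → ℝ) (g : Rd d → ℂ) (S : ℝ),
        IsOpen V → (∀ x ∈ V, 0 < ω x) → Measurable g →
        (∀ K : Set (Rd d), K ⊆ V + Metric.ball 0 ε → IsCompact K →
          ∃ B : ℝ, ∀ x ∈ K, ‖g x‖ ≤ B) →
        (∀ x ∈ V, ∀ h : Rd d, ‖h‖ ≤ ε → ‖g (x + h)‖ ≤ S * ω x) →
        ∃ g₀ g₁ : Rd d → ℂ, ContinuousOn g₀ V ∧ ContinuousOn g₁ V ∧
          (∀ x ∈ V, ‖g₀ x‖ ≤ c₀ * S * ω x) ∧ (∀ x ∈ V, ‖g₁ x‖ ≤ c₁ * S * ω x) ∧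
          ∀ φ : Rd d → ℂ, ContDiff ℝ (⊤ : ℕ∞) φ → HasCompactSupport φ → tsupport φ ⊆ V →
            (∫ x in V, g x * φ x) = (∫ x in V, g₁ x * lapl φ x) + ∫ x in V, g₀ x * φ x := by
  intro ε hε d _
  obtain ⟨a, rfl⟩ : ∃ a, ε = a + a := ⟨ε / 2, (add_halves ε).symm⟩
  have ha : 0 < a := by linarith
  refine ⟨1, one_pos, (∫ p : ℝ × Rd d, |parametrixWeight a p| ∂(volume.prod volume)) + 1,
    by positivity, ?_⟩
  intro V ω g S hV hω hg hbdd hS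
  have hS' : ∀ x ∈ V, 0 ≤ S * ω x := fun x hx =>
    (norm_nonneg _).trans (hS x hx 0 (by simpa using hε.le))
  have hball : ∀ x ∈ V, ∀ y ∈ Metric.closedBall x (a + a), ‖g y‖ ≤ S * ω x := fun x hx y hy => by
    simpa using hS x hx (y - x) (by rwa [Metric.mem_closedBall, dist_eq_norm] at hy)
  refine ⟨translateAvg volume ballWeight (fun z : Rd d => a • z) g,
    fun x => translateAvg (volume.prod volume) (parametrixWeight a)
      (fun p : ℝ × Rd d => p.1 • p.2) g x, fun x hx => ?_, fun x hx => ?_, fun x hx => ?_,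
      fun x hx => ?_, fun φ hφ hφs hφV => ?_⟩
  · exact (continuousAt_translateAvg ha (fun z hz => norm_smul_le_of_ballWeight_ne_zero ha hz)
      (fun f hf ⟨B, hB⟩ => continuous_translateAvg_ballWeight ha.ne' hf hB) hg
      (hball x hx)).continuousWithinAt
  · exact (continuousAt_translateAvg ha (fun p hp => norm_smul_le_of_parametrixWeight_ne_zero hp)
      (fun f hf ⟨B, hB⟩ => continuous_translateAvg_parametrixWeight a hf hB) hg
      (hball x hx)).continuousWithinAt
  · refine (norm_translateAvg_le integrable_ballWeight fun z hz => hS x hx _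
      ((norm_smul_le_of_ballWeight_ne_zero ha hz).trans (by linarith))).trans_eq ?_
    rw [integral_abs_ballWeight, mul_assoc]
  · refine (norm_translateAvg_le (integrable_parametrixWeight a) fun p hp => hS x hx _
      ((norm_smul_le_of_parametrixWeight_ne_zero hp).trans (by linarith))).trans ?_
    rw [mul_assoc]
    exact mul_le_mul_of_nonneg_right (by linarith) (hS' x hx)
  · set N : Set (Rd d) := tsupport φ + Metric.closedBall 0 a with hN
    have hNc : IsCompact N := IsCompact.add hφs (isCompact_closedBall 0 a)
    obtain ⟨B, hB⟩ := hbdd N (Set.add_subset_add hφV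
      (Metric.closedBall_subset_ball (by linarith))) hNc
    have hmem : ∀ x ∈ tsupport φ, ∀ h : Rd d, ‖h‖ ≤ a → N.indicator g (x + h) = g (x + h) :=
      fun x hx h hh => Set.indicator_of_mem (Set.add_mem_add hx (by simpa using hh)) g
    have hfB : ∀ x, ‖N.indicator g x‖ ≤ max B 0 := fun x => by
      by_cases hx : x ∈ N
      · rw [Set.indicator_of_mem hx]; exact (hB x hx).trans (le_max_left _ _)
      · rw [Set.indicator_of_notMem hx]; simp
    rw [setIntegral_eq_integral_of_tsupport_subset hφV
        (fun x hx => image_eq_zero_of_notMem_tsupport hx) g (N.indicator g)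
        fun x hx => by simpa using (hmem x hx 0 (by simpa using ha.le)).symm,
      setIntegral_eq_integral_of_tsupport_subset hφV
        (fun x hx => lapl_eq_zero_of_notMem_tsupport hx) _ _
        fun x hx => translateAvg_congr fun p hp =>
          (hmem x hx _ (norm_smul_le_of_parametrixWeight_ne_zero hp)).symm,
      setIntegral_eq_integral_of_tsupport_subset hφV
        (fun x hx => image_eq_zero_of_notMem_tsupport hx) _ _
        fun x hx => translateAvg_congr fun z hz =>
          (hmem x hx _ (norm_smul_le_of_ballWeight_ne_zero ha hz)).symm]
    exact integral_mul_eq_of_bounded ha (hg.indicator hNc.measurableSet) hfB hφ hφs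
end
end
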